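/- Let E(A'_n) denote the average, over all reduced words i₁⋯i_ℓ for the longest element w₀ ∈ S_n chosen uniformly at random, of the number of positions k ∈ {1,…,ℓ−1} with |i_k − i_{k+1}| = 1 (consecutive noncommuting pairs). Then lim_{n→∞} E(A'_n)/n = 128/(9π²). -/

import Mathlib

open scoped Classical


/-- The adjacent transposition `sᵢ ∈ S_n` swapping `i` and `i+1` (one-based),
for `i ∈ {1, …, n-1}`; junk value `1` otherwise. -/
def simpleRefl (n i : ℕ) : Equiv.Perm (Fin n) :=
  if h : 1 ≤ i ∧ i < n then Equiv.swap ⟨i - 1, by omega⟩ ⟨i, h.2⟩ else 1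

/-- The product `s_{i₁} ⋯ s_{i_m}` of the word `i₁ ⋯ i_m`. -/
def wordProd (n : ℕ) (l : List ℕ) : Equiv.Perm (Fin n) :=
  (l.map (simpleRefl n)).prod

/-- `l` is a word for `w`: letters in `{1, …, n-1}` and product `w`. -/
def IsWordFor (n : ℕ) (w : Equiv.Perm (Fin n)) (l : List ℕ) : Prop :=
  (∀ i ∈ l, 1 ≤ i ∧ i ≤ n - 1) ∧ wordProd n l = w

/-- `l` is a reduced word for `w`: a word for `w` of minimal length. -/
def IsReducedWordFor (n : ℕ) (w : Equiv.Perm (Fin n)) (l : List ℕ) : Prop :=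
  IsWordFor n w l ∧ ∀ l', IsWordFor n w l' → l.length ≤ l'.length

/-- The longest element `w₀ ∈ S_n`, `w₀(i) = n + 1 - i` in one-line notation. -/
def w₀ (n : ℕ) : Equiv.Perm (Fin n) := Fin.revPerm

/-- The number of positions of the word `l` supporting a commutation,
i.e. positions `k` with `|i_k - i_{k+1}| > 1`. -/
def commCount (l : List ℕ) : ℕ :=
  ((Finset.range (l.length - 1)).filter
    (fun k => 1 < |(l.getD k 0 : ℤ) - (l.getD (k+1) 0 : ℤ)|)).card

/-- The number of consecutive noncommuting pairs in the word `l`,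
i.e. positions `k` with `|i_k - i_{k+1}| = 1`. -/
def noncommCount (l : List ℕ) : ℕ :=
  ((Finset.range (l.length - 1)).filter
    (fun k => |(l.getD k 0 : ℤ) - (l.getD (k+1) 0 : ℤ)| = 1)).card

/-- The number of positions of `l` supporting a long braid move, i.e. positions `k`
with `(i_k, i_{k+1}, i_{k+2})` of the form `(i, i+1, i)` or `(i+1, i, i+1)`. -/
noncomputable def braidCount (l : List ℕ) : ℕ :=
  ((Finset.range (l.length - 2)).filter
    (fun k => ∃ i : ℕ,
      (l.getD k 0, l.getD (k+1) 0, l.getD (k+2) 0) = (i, i+1, i) ∨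
      (l.getD k 0, l.getD (k+1) 0, l.getD (k+2) 0) = (i+1, i, i+1))).card


/-- The average of the statistic `f` over all reduced words for `w₀ ∈ S_n`. -/
noncomputable def expectedStat (n : ℕ) (f : List ℕ → ℕ) : ℝ :=
  (∑ᶠ l ∈ {l : List ℕ | IsReducedWordFor n (w₀ n) l}, (f l : ℝ)) /
    (Nat.card {l : List ℕ // IsReducedWordFor n (w₀ n) l} : ℝ)

/-- The adjacent transposition of `Fin (m + 1)` exchanging `i` and `i + 1` (zero-based). -/
abbrev adjSwap {m : ℕ} (i : Fin m) : Equiv.Perm (Fin (m + 1)) :=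
  Equiv.swap i.castSucc i.succ

lemma simpleRefl_succ {m : ℕ} (i : Fin m) : simpleRefl (m + 1) (i + 1) = adjSwap i := by
  have h : 1 ≤ (i : ℕ) + 1 ∧ (i : ℕ) + 1 < m + 1 := by omega
  rw [simpleRefl, dif_pos h]
  rfl

lemma adjSwap_lt_iff {m : ℕ} (i : Fin m) (x y : Fin (m + 1))
    (h1 : ¬ (x = i.castSucc ∧ y = i.succ)) (h2 : ¬ (x = i.succ ∧ y = i.castSucc)) :
    adjSwap i x < adjSwap i y ↔ x < y := by
  simp only [adjSwap, Equiv.swap_apply_def, Fin.ext_iff, Fin.lt_def, Fin.val_castSucc,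
    Fin.val_succ] at *
  split_ifs <;> simp_all <;> omega

/-- The number of inversions of a permutation. -/
def invCount {n : ℕ} (w : Equiv.Perm (Fin n)) : ℕ :=
  (Finset.univ.filter fun p : Fin n × Fin n => p.1 < p.2 ∧ w p.2 < w p.1).card

lemma invCount_inv {n : ℕ} (w : Equiv.Perm (Fin n)) : invCount w⁻¹ = invCount w := by
  unfold invCount
  refine Finset.card_bij' (fun p _ => (w⁻¹ p.2, w⁻¹ p.1)) (fun p _ => (w p.2, w p.1)) ?_ ?_ ?_ ?_
  · simp +contextual
  · simp +contextual
  · simp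
  · simp

lemma invCount_mul_adjSwap_of_desc {m : ℕ} (w : Equiv.Perm (Fin (m + 1))) (i : Fin m)
    (h : w i.succ < w i.castSucc) : invCount (w * adjSwap i) + 1 = invCount w := by
  have key : invCount (w * adjSwap i) =
      ((Finset.univ.filter fun p : Fin (m + 1) × Fin (m + 1) =>
        p.1 < p.2 ∧ w p.2 < w p.1).erase (i.castSucc, i.succ)).card := by
    unfold invCount
    refine Finset.card_bij' (fun p _ => (adjSwap i p.1, adjSwap i p.2))
      (fun p _ => (adjSwap i p.1, adjSwap i p.2)) ?_ ?_ ?_ ?_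
    · rintro ⟨p, q⟩ hp
      obtain ⟨-, hpq, hw⟩ := Finset.mem_filter.1 hp
      simp only [Equiv.Perm.coe_mul, Function.comp_apply] at hpq hw
      have h1 : ¬ (p = i.castSucc ∧ q = i.succ) := by
        rintro ⟨rfl, rfl⟩
        rw [Equiv.swap_apply_left, Equiv.swap_apply_right] at hw
        exact absurd h (not_lt.2 hw.le)
      have h2 : ¬ (p = i.succ ∧ q = i.castSucc) := by
        rintro ⟨rfl, rfl⟩
        exact absurd hpq (not_lt.2 (Fin.castSucc_lt_succ (i := i)).le)
      rw [Finset.mem_erase, Finset.mem_filter, ne_eq, Prod.mk.injEq]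
      refine ⟨?_, Finset.mem_univ _, (adjSwap_lt_iff i p q h1 h2).2 hpq, hw⟩
      rintro ⟨h3, h4⟩
      apply h2
      rw [Equiv.swap_apply_eq_iff, Equiv.swap_apply_left] at h3
      rw [Equiv.swap_apply_eq_iff, Equiv.swap_apply_right] at h4
      exact ⟨h3, h4⟩
    · rintro ⟨p, q⟩ hp
      rw [Finset.mem_erase, Finset.mem_filter, ne_eq, Prod.mk.injEq] at hp
      obtain ⟨h1, -, hpq, hw⟩ := hp
      have h2 : ¬ (p = i.succ ∧ q = i.castSucc) := by
        rintro ⟨rfl, rfl⟩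
        exact absurd hpq (not_lt.2 (Fin.castSucc_lt_succ (i := i)).le)
      refine Finset.mem_filter.2 ⟨Finset.mem_univ _, (adjSwap_lt_iff i p q h1 h2).2 hpq, ?_⟩
      simpa [adjSwap] using hw
    · simp [adjSwap]
    · simp [adjSwap]
  rw [key, Finset.card_erase_add_one]
  · rfl
  · exact Finset.mem_filter.2 ⟨Finset.mem_univ _, Fin.castSucc_lt_succ, h⟩

lemma invCount_mul_adjSwap_of_asc {m : ℕ} (w : Equiv.Perm (Fin (m + 1))) (i : Fin m)
    (h : w i.castSucc < w i.succ) : invCount (w * adjSwap i) = invCount w + 1 := by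
  have := invCount_mul_adjSwap_of_desc (w * adjSwap i) i (by simpa [adjSwap] using h)
  rw [← this, mul_assoc, Equiv.swap_mul_self, mul_one]

lemma adjSwap_mul_inv {m : ℕ} (w : Equiv.Perm (Fin (m + 1))) (i : Fin m) :
    (adjSwap i * w)⁻¹ = w⁻¹ * adjSwap i := by
  rw [mul_inv_rev, Equiv.swap_inv]

lemma invCount_adjSwap_mul_of_desc {m : ℕ} (w : Equiv.Perm (Fin (m + 1))) (i : Fin m)
    (h : w⁻¹ i.succ < w⁻¹ i.castSucc) : invCount (adjSwap i * w) + 1 = invCount w := by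
  rw [← invCount_inv, adjSwap_mul_inv, invCount_mul_adjSwap_of_desc _ _ h, invCount_inv]

lemma invCount_adjSwap_mul_of_asc {m : ℕ} (w : Equiv.Perm (Fin (m + 1))) (i : Fin m)
    (h : w⁻¹ i.castSucc < w⁻¹ i.succ) : invCount (adjSwap i * w) = invCount w + 1 := by
  rw [← invCount_inv, adjSwap_mul_inv, invCount_mul_adjSwap_of_asc _ _ h, invCount_inv]

lemma eq_one_of_invCount_eq_zero {n : ℕ} (w : Equiv.Perm (Fin n)) (h : invCount w = 0) :
    w = 1 := by
  have hm : Monotone w := by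
    intro a b hab
    rcases hab.eq_or_lt with rfl | hab
    · exact le_rfl
    by_contra! hc
    have : (a, b) ∈ Finset.univ.filter
        fun p : Fin n × Fin n => p.1 < p.2 ∧ w p.2 < w p.1 := by simp [hab, hc]
    rw [Finset.card_eq_zero.1 h] at this
    simp at this
  have hs : StrictMono w := hm.strictMono_of_injective w.injective
  let e : Fin n ≃o Fin n := ⟨w, hs.le_iff_le⟩
  have : e = OrderIso.refl _ := Subsingleton.elim _ _
  ext x
  have := congrArg (fun f : Fin n ≃o Fin n => f x) this
  simpa [e] using congrArg Fin.val this

lemma invCount_one {n : ℕ} : invCount (1 : Equiv.Perm (Fin n)) = 0 := by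
  unfold invCount
  rw [Finset.card_eq_zero, Finset.filter_eq_empty_iff]
  rintro ⟨p, q⟩ -
  simp only [Equiv.Perm.coe_one, id_eq, not_and, not_lt]
  exact fun h => h.le

/-- The words of length `k` with product `w`. -/
noncomputable def wordsOfLength {m : ℕ} : ℕ → Equiv.Perm (Fin (m + 1)) → Finset (List ℕ)
  | 0, w => if w = 1 then {[]} else ∅
  | k + 1, w => Finset.univ.biUnion fun i : Fin m =>
      (wordsOfLength k (adjSwap i * w)).image (List.cons (i + 1))

lemma isWordFor_cons {m : ℕ} (w : Equiv.Perm (Fin (m + 1))) (i : Fin m) (l : List ℕ) :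
    IsWordFor (m + 1) w ((i + 1 : ℕ) :: l) ↔ IsWordFor (m + 1) (adjSwap i * w) l := by
  simp only [IsWordFor, wordProd, List.mem_cons, forall_eq_or_imp, List.map_cons, List.prod_cons,
    simpleRefl_succ]
  have : adjSwap i * (l.map (simpleRefl (m + 1))).prod = w ↔
      (l.map (simpleRefl (m + 1))).prod = adjSwap i * w := by
    rw [← inv_mul_eq_iff_eq_mul, Equiv.swap_inv]
  rw [this]
  have := i.2
  constructor
  · rintro ⟨⟨_, h⟩, h2⟩; exact ⟨h, h2⟩
  · rintro ⟨h, h2⟩; exact ⟨⟨by omega, h⟩, h2⟩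

lemma mem_wordsOfLength {m : ℕ} (k : ℕ) (w : Equiv.Perm (Fin (m + 1))) (l : List ℕ) :
    l ∈ wordsOfLength k w ↔ l.length = k ∧ IsWordFor (m + 1) w l := by
  induction k generalizing w l with
  | zero =>
    simp only [wordsOfLength, List.length_eq_zero_iff]
    split_ifs with h
    · subst h
      simp only [Finset.mem_singleton]
      constructor
      · rintro rfl; simp [IsWordFor, wordProd]
      · exact fun h => h.1
    · simp only [Finset.notMem_empty, false_iff]
      rintro ⟨rfl, h2⟩
      exact h (by simpa [IsWordFor, wordProd, eq_comm] using h2)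
  | succ k ih =>
    simp only [wordsOfLength, Finset.mem_biUnion, Finset.mem_univ, true_and, Finset.mem_image, ih]
    constructor
    · rintro ⟨i, l', ⟨h1, h2⟩, rfl⟩
      exact ⟨by simp [h1], (isWordFor_cons w i l').2 h2⟩
    · rintro ⟨h1, h2⟩
      obtain ⟨a, l', rfl⟩ := List.exists_cons_of_length_eq_add_one h1
      have ha := h2.1 a (by simp)
      have : a = ((⟨a - 1, by omega⟩ : Fin m) : ℕ) + 1 := by simp; omega
      rw [this] at h2 ⊢
      exact ⟨_, l', ⟨by simpa using h1, (isWordFor_cons w _ l').1 h2⟩, rfl⟩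

lemma card_wordsOfLength_succ {m : ℕ} (k : ℕ) (w : Equiv.Perm (Fin (m + 1))) :
    (wordsOfLength (k + 1) w).card = ∑ i : Fin m, (wordsOfLength k (adjSwap i * w)).card := by
  rw [wordsOfLength, Finset.card_biUnion]
  · refine Finset.sum_congr rfl fun i _ => Finset.card_image_of_injective _ List.cons_injective
  · intro i _ j _ hij
    rw [Function.onFun, Finset.disjoint_left]
    simp only [Finset.mem_image, not_exists, not_and, forall_exists_index, and_imp]
    rintro _ l _ rfl l' _ h
    simp only [List.cons.injEq, add_left_inj] at h
    exact hij (Fin.ext h.1.symm)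

lemma isWordFor_reverse {n : ℕ} (w : Equiv.Perm (Fin n)) (l : List ℕ) (h : IsWordFor n w l) :
    IsWordFor n w⁻¹ l.reverse := by
  refine ⟨by simpa using h.1, ?_⟩
  rw [← h.2, wordProd, wordProd, List.prod_inv_reverse, List.map_reverse, List.map_map]
  congr 2
  refine List.map_congr_left fun i _ => ?_
  simp only [Function.comp_apply, simpleRefl]
  split_ifs <;> simp

lemma card_wordsOfLength_inv {m : ℕ} (k : ℕ) (w : Equiv.Perm (Fin (m + 1))) :
    (wordsOfLength k w⁻¹).card = (wordsOfLength k w).card := by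
  have key : ∀ w : Equiv.Perm (Fin (m + 1)),
      (wordsOfLength k w).card ≤ (wordsOfLength k w⁻¹).card := by
    intro w
    refine Finset.card_le_card_of_injOn List.reverse ?_ (List.reverse_injective.injOn)
    intro l hl
    simp only [Finset.mem_coe, mem_wordsOfLength, List.length_reverse] at hl ⊢
    exact ⟨hl.1, isWordFor_reverse w l hl.2⟩
  refine le_antisymm ?_ (key w)
  simpa using key w⁻¹

lemma invCount_le_of_isWordFor {m : ℕ} (w : Equiv.Perm (Fin (m + 1))) (l : List ℕ)
    (h : IsWordFor (m + 1) w l) : invCount w ≤ l.length := by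
  induction l generalizing w with
  | nil =>
    have : w = 1 := by simpa [IsWordFor, wordProd, eq_comm] using h
    simp [this, invCount_one]
  | cons a l ih =>
    have ha := h.1 a (by simp)
    have : a = ((⟨a - 1, by omega⟩ : Fin m) : ℕ) + 1 := by simp; omega
    rw [this, isWordFor_cons] at h
    have h1 := ih _ h
    set i : Fin m := ⟨a - 1, by omega⟩
    have hne : w⁻¹ i.succ ≠ w⁻¹ i.castSucc := by
      simp [Fin.ext_iff]
    rcases hne.lt_or_gt with h2 | h2
    · have := invCount_adjSwap_mul_of_desc w i h2
      simp; omega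
    · have := invCount_adjSwap_mul_of_asc w i h2
      simp; omega

lemma wordsOfLength_eq_empty {m : ℕ} (k : ℕ) (w : Equiv.Perm (Fin (m + 1)))
    (h : k < invCount w) : wordsOfLength k w = ∅ := by
  refine Finset.eq_empty_of_forall_notMem fun l hl => ?_
  rw [mem_wordsOfLength] at hl
  have := invCount_le_of_isWordFor w l hl.2
  omega

/-- The number of reduced words of a permutation. -/
noncomputable def reducedCount {m : ℕ} (w : Equiv.Perm (Fin (m + 1))) : ℕ :=
  (wordsOfLength (invCount w) w).card

lemma reducedCount_inv {m : ℕ} (w : Equiv.Perm (Fin (m + 1))) :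
    reducedCount w⁻¹ = reducedCount w := by
  rw [reducedCount, invCount_inv, card_wordsOfLength_inv, reducedCount]

lemma reducedCount_one {m : ℕ} : reducedCount (1 : Equiv.Perm (Fin (m + 1))) = 1 := by
  rw [reducedCount, invCount_one]
  simp [wordsOfLength]

lemma reducedCount_eq_sum_left {m : ℕ} (w : Equiv.Perm (Fin (m + 1))) (h : invCount w ≠ 0) :
    reducedCount w = ∑ i : Fin m,
      if w⁻¹ i.succ < w⁻¹ i.castSucc then reducedCount (adjSwap i * w) else 0 := by
  obtain ⟨k, hk⟩ := Nat.exists_eq_succ_of_ne_zero h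
  rw [reducedCount, hk, Nat.succ_eq_add_one, card_wordsOfLength_succ]
  refine Finset.sum_congr rfl fun i _ => ?_
  have hne : w⁻¹ i.succ ≠ w⁻¹ i.castSucc := by simp [Fin.ext_iff]
  split_ifs with h1
  · have := invCount_adjSwap_mul_of_desc w i h1
    rw [reducedCount]
    congr 2
    omega
  · have := invCount_adjSwap_mul_of_asc w i (lt_of_le_of_ne (not_lt.1 h1) hne.symm)
    rw [wordsOfLength_eq_empty _ _ (by omega), Finset.card_empty]

lemma reducedCount_eq_sum_right {m : ℕ} (w : Equiv.Perm (Fin (m + 1))) (h : invCount w ≠ 0) :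
    reducedCount w = ∑ i : Fin m,
      if w i.succ < w i.castSucc then reducedCount (w * adjSwap i) else 0 := by
  rw [← reducedCount_inv, reducedCount_eq_sum_left _ (by rwa [invCount_inv])]
  refine Finset.sum_congr rfl fun i _ => ?_
  rw [inv_inv, ← reducedCount_inv, adjSwap_mul_inv, inv_inv]

/-- `w * swap a b` covers `w` in the Bruhat order, with `a < b`. -/
def IsBruhatCover {n : ℕ} (w : Equiv.Perm (Fin n)) (a b : Fin n) : Prop :=
  a < b ∧ w a < w b ∧ ∀ j, a < j → j < b → ¬ (w a < w j ∧ w j < w b)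

lemma isBruhatCover_adjSwap_mul_iff {m : ℕ} (w : Equiv.Perm (Fin (m + 1))) (k : Fin m)
    (a b : Fin (m + 1))
    (h1 : ¬ (w a = k.castSucc ∧ w b = k.succ)) (h2 : ¬ (w a = k.succ ∧ w b = k.castSucc)) :
    (IsBruhatCover w a b ∧ (w * Equiv.swap a b)⁻¹ k.succ < (w * Equiv.swap a b)⁻¹ k.castSucc) ↔
      (w⁻¹ k.succ < w⁻¹ k.castSucc ∧ IsBruhatCover (adjSwap k * w) a b) := by
  simp only [mul_inv_rev, Equiv.swap_inv, Equiv.Perm.coe_mul, Function.comp_apply, IsBruhatCover]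
  obtain ⟨P, hP⟩ : ∃ P, P = w⁻¹ k.castSucc := ⟨_, rfl⟩
  obtain ⟨Q, hQ⟩ : ∃ Q, Q = w⁻¹ k.succ := ⟨_, rfl⟩
  rw [← hP, ← hQ]
  have eP : ∀ j, w j = k.castSucc ↔ j = P := by
    intro j; rw [hP, Equiv.Perm.eq_inv_iff_eq]
  have eQ : ∀ j, w j = k.succ ↔ j = Q := by
    intro j; rw [hQ, Equiv.Perm.eq_inv_iff_eq]
  have hlt : ∀ x y, ¬ (x = P ∧ y = Q) → ¬ (x = Q ∧ y = P) →
      (adjSwap k (w x) < adjSwap k (w y) ↔ w x < w y) := by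
    intro x y hx hy
    apply adjSwap_lt_iff
    · rwa [eP, eQ]
    · rwa [eP, eQ]
  have hPQ : P ≠ Q := by
    rw [hP, hQ]; simp [Fin.ext_iff]
  have vP := (eP P).2 rfl
  have vQ := (eQ Q).2 rfl
  have inj : ∀ x y, w x = w y ↔ x = y := fun x y => w.injective.eq_iff
  have lts : ∀ x, w P < x → x ≠ w Q → w Q < x := by
    intro x; rw [vP, vQ]; simp only [Fin.lt_def, Fin.ext_iff, ne_eq]; simp; omega
  have lts' : ∀ x, x < w Q → x ≠ w P → x < w P := by
    intro x; rw [vP, vQ]; simp only [Fin.lt_def, Fin.ext_iff, ne_eq]; simp; omega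
  have hPltQ : w P < w Q := by rw [vP, vQ]; exact Fin.castSucc_lt_succ
  have sP : adjSwap k (w P) = w Q := by rw [vP, vQ]; simp [adjSwap]
  have sQ : adjSwap k (w Q) = w P := by rw [vP, vQ]; simp [adjSwap]
  rw [eP, eQ] at h1 h2
  rw [hlt a b h1 h2]
  simp only [Equiv.swap_apply_def]
  clear hP hQ eP eQ vP vQ
  constructor
  · rintro ⟨⟨hab, hw, hc⟩, hd⟩
    refine ⟨?_, hab, hw, ?_⟩
    · have := hc P; have := hc Q; grind
    · intro j haj hjb ⟨h3, h4⟩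
      have := hc j haj hjb
      have := hlt a j; have := hlt j b
      grind
  · rintro ⟨hd, hab, hw, hc⟩
    refine ⟨⟨hab, hw, ?_⟩, ?_⟩
    · intro j haj hjb ⟨h3, h4⟩
      have := hc j haj hjb
      have := hlt a j; have := hlt j b
      grind
    · have := hc P; have := hc Q
      have := hlt a P; have := hlt a Q; have := hlt P b; have := hlt Q b
      grind

/-- The number of reduced words of `w * swap a b` if that permutation covers `w`, else `0`. -/
noncomputable def coverCount {m : ℕ} (w : Equiv.Perm (Fin (m + 1))) (a b : Fin (m + 1)) : ℤ :=
  if IsBruhatCover w a b then (reducedCount (w * Equiv.swap a b) : ℤ) else 0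

lemma coverCount_letter {m : ℕ} (w : Equiv.Perm (Fin (m + 1))) (k : Fin m)
    (a b : Fin (m + 1)) (hab : a < b) :
    (if IsBruhatCover w a b then
      (if (w * Equiv.swap a b)⁻¹ k.succ < (w * Equiv.swap a b)⁻¹ k.castSucc then
        (reducedCount (adjSwap k * (w * Equiv.swap a b)) : ℤ) else 0) else 0) =
    (if w⁻¹ k.succ < w⁻¹ k.castSucc then coverCount (adjSwap k * w) a b else 0) +
      ((if w a = k.castSucc ∧ w b = k.succ then (reducedCount w : ℤ) else 0) -
        (if w a = k.succ ∧ w b = k.castSucc then (reducedCount w : ℤ) else 0)) := by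
  have hks : k.castSucc < k.succ := Fin.castSucc_lt_succ
  by_cases h1 : w a = k.castSucc ∧ w b = k.succ
  · have ha : w⁻¹ k.castSucc = a := by rw [← h1.1]; simp
    have hb : w⁻¹ k.succ = b := by rw [← h1.2]; simp
    have hcov : IsBruhatCover w a b := by
      refine ⟨hab, by rw [h1.1, h1.2]; exact hks, ?_⟩
      intro j _ _
      rw [h1.1, h1.2]
      simp only [Fin.lt_def, Fin.val_castSucc, Fin.val_succ]
      omega
    have hd : (w * Equiv.swap a b)⁻¹ k.succ < (w * Equiv.swap a b)⁻¹ k.castSucc := by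
      simp only [mul_inv_rev, Equiv.swap_inv, Equiv.Perm.coe_mul, Function.comp_apply, ha, hb]
      simpa using hab
    have hnd : ¬ w⁻¹ k.succ < w⁻¹ k.castSucc := by rw [ha, hb]; exact hab.le.not_gt
    have h2 : ¬ (w a = k.succ ∧ w b = k.castSucc) := by
      rw [h1.1]; exact fun h => hks.ne h.1
    have hw : adjSwap k * (w * Equiv.swap a b) = w := by
      rw [adjSwap, ← h1.1, ← h1.2, Equiv.swap_apply_apply]
      simp [mul_assoc]
    rw [if_pos hcov, if_pos hd, if_neg hnd, if_pos h1, if_neg h2, hw]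
    ring
  by_cases h2 : w a = k.succ ∧ w b = k.castSucc
  · have ha : w⁻¹ k.succ = a := by rw [← h2.1]; simp
    have hb : w⁻¹ k.castSucc = b := by rw [← h2.2]; simp
    have hncov : ¬ IsBruhatCover w a b := by
      intro h
      have := h.2.1
      rw [h2.1, h2.2] at this
      exact absurd this hks.le.not_gt
    have hcov : IsBruhatCover (adjSwap k * w) a b := by
      have e1 : (adjSwap k * w) a = k.castSucc := by simp [adjSwap, h2.1]
      have e2 : (adjSwap k * w) b = k.succ := by simp [adjSwap, h2.2]
      refine ⟨hab, by rw [e1, e2]; exact hks, ?_⟩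
      intro j _ _
      rw [e1, e2]
      simp only [Fin.lt_def, Fin.val_castSucc, Fin.val_succ]
      omega
    have hd : w⁻¹ k.succ < w⁻¹ k.castSucc := by rw [ha, hb]; exact hab
    have hw : adjSwap k * w * Equiv.swap a b = w := by
      rw [adjSwap, Equiv.swap_comm, ← h2.1, ← h2.2, Equiv.swap_apply_apply]
      simp [mul_assoc]
    rw [if_neg hncov, if_pos hd, if_neg h1, if_pos h2, coverCount, if_pos hcov, hw]
    ring
  · rw [if_neg h1, if_neg h2, sub_zero, add_zero, coverCount, mul_assoc, ← ite_and, ← ite_and]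
    exact if_congr (isBruhatCover_adjSwap_mul_iff w k a b h1 h2) rfl rfl

lemma invCount_ne_zero_of_isBruhatCover {m : ℕ} {w : Equiv.Perm (Fin (m + 1))}
    {a b : Fin (m + 1)} (h : IsBruhatCover w a b) : invCount (w * Equiv.swap a b) ≠ 0 := by
  intro h0
  have h1 := eq_one_of_invCount_eq_zero _ h0
  have e1 : (w * Equiv.swap a b) a = w b := by simp
  have e2 : (w * Equiv.swap a b) b = w a := by simp
  rw [h1] at e1 e2
  simp only [Equiv.Perm.coe_one, id_eq] at e1 e2
  have := h.2.1
  rw [← e1, ← e2] at this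
  exact absurd this h.1.le.not_gt

lemma coverCount_eq {m : ℕ} (w : Equiv.Perm (Fin (m + 1))) (a b : Fin (m + 1)) (hab : a < b) :
    coverCount w a b =
      (∑ k : Fin m, if w⁻¹ k.succ < w⁻¹ k.castSucc then coverCount (adjSwap k * w) a b else 0) +
      ∑ k : Fin m, ((if w a = k.castSucc ∧ w b = k.succ then (reducedCount w : ℤ) else 0) -
        (if w a = k.succ ∧ w b = k.castSucc then (reducedCount w : ℤ) else 0)) := by
  rw [← Finset.sum_add_distrib, ← Finset.sum_congr rfl fun k _ => coverCount_letter w k a b hab]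
  rw [coverCount]
  split_ifs with h
  · rw [reducedCount_eq_sum_left _ (invCount_ne_zero_of_isBruhatCover h)]
    push_cast
    rfl
  · simp

/-- The signed sum of `coverCount` over all covers moving the position `r`. -/
noncomputable def transitionSum {m : ℕ} (w : Equiv.Perm (Fin (m + 1))) (r : Fin (m + 1)) : ℤ :=
  ∑ s, ((if r < s then coverCount w r s else 0) - (if s < r then coverCount w s r else 0))

lemma transitionSum_boundary {m : ℕ} (w : Equiv.Perm (Fin (m + 1))) (r : Fin (m + 1)) (c : ℤ)
    (h0 : w r ≠ 0) (h1 : w r ≠ Fin.last m) :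
    ∑ s, ((if r < s then
        ∑ k : Fin m, ((if w r = k.castSucc ∧ w s = k.succ then c else 0) -
          (if w r = k.succ ∧ w s = k.castSucc then c else 0)) else 0) -
      (if s < r then
        ∑ k : Fin m, ((if w s = k.castSucc ∧ w r = k.succ then c else 0) -
          (if w s = k.succ ∧ w r = k.castSucc then c else 0)) else 0)) = 0 := by
  have step : ∀ s, ((if r < s then
        ∑ k : Fin m, ((if w r = k.castSucc ∧ w s = k.succ then c else 0) -
          (if w r = k.succ ∧ w s = k.castSucc then c else 0)) else 0) -
      (if s < r then
        ∑ k : Fin m, ((if w s = k.castSucc ∧ w r = k.succ then c else 0) -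
          (if w s = k.succ ∧ w r = k.castSucc then c else 0)) else 0)) =
      ∑ k : Fin m, ((if w r = k.castSucc ∧ w s = k.succ then c else 0) -
          (if w r = k.succ ∧ w s = k.castSucc then c else 0)) := by
    intro s
    rcases lt_trichotomy r s with h | h | h
    · rw [if_pos h, if_neg h.not_gt, sub_zero]
    · subst h
      rw [if_neg (lt_irrefl _), sub_self]
      symm
      apply Finset.sum_eq_zero
      intro k _
      have hk := (Fin.castSucc_lt_succ (i := k)).ne
      rw [if_neg, if_neg, sub_self]
      · rintro ⟨h1, h2⟩; exact hk (h2.symm.trans h1)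
      · rintro ⟨h1, h2⟩; exact hk (h1.symm.trans h2)
    · rw [if_pos h, if_neg h.not_gt, zero_sub, ← Finset.sum_neg_distrib]
      refine Finset.sum_congr rfl fun k _ => ?_
      rw [neg_sub]
      congr 1 <;> exact if_congr and_comm rfl rfl
  rw [Finset.sum_congr rfl fun s _ => step s, Finset.sum_comm]
  have inner : ∀ k : Fin m, ∑ s, ((if w r = k.castSucc ∧ w s = k.succ then c else 0) -
          (if w r = k.succ ∧ w s = k.castSucc then c else 0)) =
      (if w r = k.castSucc then c else 0) - (if w r = k.succ then c else 0) := by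
    intro k
    rw [Finset.sum_sub_distrib]
    have e : ∀ x y : Fin (m + 1), ∑ s, (if w r = x ∧ w s = y then c else 0) =
        if w r = x then c else 0 := by
      intro x y
      rw [Finset.sum_eq_single (w⁻¹ y)]
      · simp
      · intro s _ hs
        rw [if_neg]
        rintro ⟨_, h⟩
        exact hs (by rw [← h]; simp)
      · simp
    rw [e, e]
  rw [Finset.sum_congr rfl fun k _ => inner k, Finset.sum_sub_distrib]
  obtain ⟨p, hp⟩ := Fin.exists_succ_eq.2 h0
  obtain ⟨q, hq⟩ := Fin.exists_castSucc_eq.2 h1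
  have e1 : ∑ k : Fin m, (if w r = k.castSucc then c else 0) = c := by
    rw [← hq]; simp
  have e2 : ∑ k : Fin m, (if w r = k.succ then c else 0) = c := by
    rw [← hp]; simp
  rw [e1, e2, sub_self]

/-- The Lascoux–Schützenberger transition formula for the number of reduced words. -/
theorem transitionSum_eq_zero {m : ℕ} (w : Equiv.Perm (Fin (m + 1))) (r p q : Fin (m + 1))
    (hp : p < r) (hwp : w p < w r) (hq : r < q) (hwq : w r < w q) : transitionSum w r = 0 := by
  obtain ⟨N, hN⟩ : ∃ N, invCount w = N := ⟨_, rfl⟩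
  induction N using Nat.strong_induction_on generalizing w with
  | _ N ih =>
  have h0 : w r ≠ 0 := ((Fin.zero_le _).trans_lt hwp).ne'
  have h1 : w r ≠ Fin.last m := (hwq.trans_le (Fin.le_last _)).ne
  have e : transitionSum w r =
      ∑ k : Fin m, if w⁻¹ k.succ < w⁻¹ k.castSucc then transitionSum (adjSwap k * w) r else 0 := by
    refine Eq.trans ?_ ((congrArg (HAdd.hAdd _)
      (transitionSum_boundary w r (reducedCount w) h0 h1)).trans (add_zero _))
    have : ∀ k : Fin m, (if w⁻¹ k.succ < w⁻¹ k.castSucc then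
        transitionSum (adjSwap k * w) r else 0) = ∑ s,
        ((if r < s then (if w⁻¹ k.succ < w⁻¹ k.castSucc then
          coverCount (adjSwap k * w) r s else 0) else 0) -
        (if s < r then (if w⁻¹ k.succ < w⁻¹ k.castSucc then
          coverCount (adjSwap k * w) s r else 0) else 0)) := by
      intro k
      split_ifs
      · rfl
      · simp
    rw [Finset.sum_congr rfl fun k _ => this k, Finset.sum_comm, ← Finset.sum_add_distrib,
      transitionSum]
    refine Finset.sum_congr rfl fun s _ => ?_
    rcases lt_trichotomy r s with h | h | h
    · simp only [if_pos h, if_neg h.not_gt, sub_zero]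
      exact coverCount_eq w r s h
    · subst h
      simp
    · simp only [if_pos h, if_neg h.not_gt, zero_sub]
      rw [coverCount_eq w s r h, Finset.sum_neg_distrib, neg_add]
  rw [e]
  apply Finset.sum_eq_zero
  intro k _
  split_ifs with hk
  · have hinv := invCount_adjSwap_mul_of_desc w k hk
    have hpres : ∀ x y : Fin (m + 1), x < y → w x < w y →
        (adjSwap k * w) x < (adjSwap k * w) y := by
      intro x y hxy hw
      rw [Equiv.Perm.coe_mul, Function.comp_apply, Function.comp_apply, adjSwap_lt_iff]
      · exact hw
      · rintro ⟨h2, h3⟩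
        rw [← h2, ← h3] at hk
        have hyx : y < x := by simpa using hk
        exact absurd hyx hxy.not_gt
      · rintro ⟨h2, h3⟩
        rw [h2, h3] at hw
        exact absurd hw (Fin.castSucc_lt_succ).not_gt
    exact ih _ (by omega) _ (hpres p r hp hwp) (hpres r q hq hwq) rfl
  · rfl

/-- The Lehmer code of a permutation. -/
def lehmerCode {n : ℕ} (w : Equiv.Perm (Fin n)) (i : Fin n) : ℕ :=
  (Finset.univ.filter fun j => i < j ∧ w j < w i).card

lemma sum_lehmerCode {n : ℕ} (w : Equiv.Perm (Fin n)) : ∑ i, lehmerCode w i = invCount w := by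
  unfold lehmerCode invCount
  rw [← Finset.card_sigma]
  refine Finset.card_bij' (fun p _ => (p.1, p.2)) (fun p _ => ⟨p.1, p.2⟩) ?_ ?_ ?_ ?_ <;> simp

lemma lehmerCode_last {m : ℕ} (w : Equiv.Perm (Fin (m + 1))) : lehmerCode w (Fin.last m) = 0 := by
  rw [lehmerCode, Finset.card_eq_zero, Finset.filter_eq_empty_iff]
  intro j _ h
  exact absurd h.1 (Fin.le_last j).not_gt

lemma lehmerCode_succ_lt {m : ℕ} (w : Equiv.Perm (Fin (m + 1))) (i : Fin m)
    (h : w i.succ < w i.castSucc) : lehmerCode w i.succ < lehmerCode w i.castSucc := by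
  refine Finset.card_lt_card ((Finset.ssubset_iff_of_subset ?_).2 ⟨i.succ, ?_, ?_⟩)
  · intro j hj
    simp only [Finset.mem_filter, Finset.mem_univ, true_and] at hj ⊢
    exact ⟨Fin.castSucc_lt_succ.trans hj.1, hj.2.trans h⟩
  · simpa using h
  · simp

lemma lehmerCode_le_succ {m : ℕ} (w : Equiv.Perm (Fin (m + 1))) (i : Fin m)
    (h : w i.castSucc < w i.succ) : lehmerCode w i.castSucc ≤ lehmerCode w i.succ := by
  refine Finset.card_le_card ?_
  intro j hj
  simp only [Finset.mem_filter, Finset.mem_univ, true_and] at hj ⊢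
  refine ⟨?_, hj.2.trans h⟩
  refine lt_of_le_of_ne (Fin.castSucc_lt_iff_succ_le.1 hj.1) ?_
  rintro rfl
  exact absurd hj.2 h.not_gt

lemma not_132_of_antitone {n : ℕ} (w : Equiv.Perm (Fin n)) (hw : Antitone (lehmerCode w))
    {p q t : Fin n} (hpq : p < q) (hqt : q < t) (h1 : w p < w t) (h2 : w t < w q) : False := by
  let S := Finset.univ.filter fun x => x < q ∧ w x < w t
  have hS : S.Nonempty := ⟨p, by simp [S, hpq, h1]⟩
  have hmem := S.max'_mem hS
  have hmax : ∀ x, x < q → w x < w t → x ≤ S.max' hS := fun x hx hx' =>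
    S.le_max' x (by simp [S, hx, hx'])
  generalize S.max' hS = p' at hmem hmax
  simp only [S, Finset.mem_filter, Finset.mem_univ, true_and] at hmem
  have : lehmerCode w p' < lehmerCode w q := by
    refine Finset.card_lt_card ((Finset.ssubset_iff_of_subset ?_).2 ⟨t, ?_, ?_⟩)
    · intro j hj
      simp only [Finset.mem_filter, Finset.mem_univ, true_and] at hj ⊢
      refine ⟨?_, hj.2.trans (hmem.2.trans h2)⟩
      by_contra! hjq
      rcases hjq.eq_or_lt with rfl | hjq
      · exact absurd (hj.2.trans hmem.2) h2.not_gt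
      · exact absurd (hmax j hjq (hj.2.trans hmem.2)) hj.1.not_ge
    · simp [hqt, h2]
    · simp [hmem.2.le]
  exact absurd (hw hmem.1.le) this.not_ge

lemma lehmerCode_mul_swap {n : ℕ} (w : Equiv.Perm (Fin n)) {i s : Fin n} (his : i < s)
    (hws : w s < w i) (hmax : ∀ j, i < j → w j < w i → w j ≤ w s) (j : Fin n) :
    lehmerCode (w * Equiv.swap i s) j + (if j = i then 1 else 0) = lehmerCode w j := by
  have inj : ∀ x y, w x = w y ↔ x = y := fun x y => w.injective.eq_iff
  rcases lt_trichotomy j i with hji | rfl | hij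
  · rw [if_neg hji.ne, add_zero]
    unfold lehmerCode
    refine Finset.card_bij' (fun x _ => Equiv.swap i s x) (fun x _ => Equiv.swap i s x) ?_ ?_
      (by simp) (by simp)
    all_goals
      intro x hx
      obtain ⟨-, h1, h2⟩ := Finset.mem_filter.1 hx
      refine Finset.mem_filter.2 ⟨Finset.mem_univ _, ?_⟩
      simp only [Equiv.Perm.coe_mul, Function.comp_apply, Equiv.swap_apply_def] at h2 ⊢
      grind
  · rw [if_pos rfl]
    have : (Finset.univ.filter fun x => j < x ∧ (w * Equiv.swap j s) x < (w * Equiv.swap j s) j) =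
        (Finset.univ.filter fun x => j < x ∧ w x < w j).erase s := by
      ext x
      rw [Finset.mem_erase, Finset.mem_filter, Finset.mem_filter]
      simp only [Finset.mem_univ, true_and, Equiv.Perm.coe_mul, Function.comp_apply,
        Equiv.swap_apply_def]
      have := hmax x
      grind
    rw [lehmerCode, this, Finset.card_erase_add_one, lehmerCode]
    exact Finset.mem_filter.2 ⟨Finset.mem_univ _, his, hws⟩
  · rw [if_neg hij.ne', add_zero]
    unfold lehmerCode
    congr 1
    ext x
    rw [Finset.mem_filter, Finset.mem_filter]
    simp only [Finset.mem_univ, true_and, Equiv.Perm.coe_mul, Function.comp_apply,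
      Equiv.swap_apply_def]
    have := hmax x
    have := hmax j
    grind

lemma isBruhatCover_iff_right {m : ℕ} (w : Equiv.Perm (Fin (m + 1)))
    (hw : Antitone (lehmerCode w)) {i : Fin m} {s : Fin (m + 1)} (his : i.succ < s)
    (hd : w i.succ < w i.castSucc)
    (hws : w s < w i.castSucc) (hmax : ∀ j, i.castSucc < j → w j < w i.castSucc → w j ≤ w s)
    (x : Fin (m + 1)) :
    (i.succ < x → (IsBruhatCover (w * Equiv.swap i.castSucc s * adjSwap i) i.succ x ↔ x = s)) ∧
    (x < i.succ → (IsBruhatCover (w * Equiv.swap i.castSucc s * adjSwap i) x i.succ ↔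
      x = i.castSucc)) := by
  have inj : ∀ x y, w x = w y ↔ x = y := fun x y => w.injective.eq_iff
  obtain ⟨a, ha⟩ : ∃ a, a = i.castSucc := ⟨_, rfl⟩
  obtain ⟨b, hb⟩ : ∃ b, b = i.succ := ⟨_, rfl⟩
  have hab : a < b := by rw [ha, hb]; exact Fin.castSucc_lt_succ
  have hbt : ∀ j, j < b → j ≠ a → j < a := by
    intro j; rw [ha, hb]; simp only [Fin.lt_def, ne_eq, Fin.ext_iff]; simp; omega
  have h132 := fun p q t => @not_132_of_antitone _ w hw p q t
  simp only [adjSwap, IsBruhatCover]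
  simp only [← ha, ← hb] at his hd hws hmax ⊢
  clear ha hb hw
  have hwbs : w b < w s := lt_of_le_of_ne (hmax b hab hd) (by rw [ne_eq, inj]; exact his.ne)
  simp only [Equiv.Perm.coe_mul, Function.comp_apply]
  have v : ∀ j, w (Equiv.swap a s (Equiv.swap a b j)) =
      if j = a then w b else if j = b then w s else if j = s then w a else w j := by
    intro j
    simp only [Equiv.swap_apply_def]
    grind
  simp only [v]
  constructor
  · intro hx
    constructor
    · rintro ⟨-, h1, h2⟩
      have := hmax x (hab.trans hx)
      have := h132 b x s
      have := h2 s
      grind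
    · rintro rfl
      refine ⟨hx, by grind, ?_⟩
      intro j hj hjs
      have := hmax j (hab.trans hj)
      grind
  · intro hx
    constructor
    · rintro ⟨-, h1, h2⟩
      have := h132 x a s
      have := h2 a
      have := hbt x hx
      grind
    · rintro rfl
      refine ⟨hx, by grind, ?_⟩
      intro j hj hjs
      have := hbt j hjs
      grind

/-- For a dominant permutation `w` with a descent at `i`, the permutation `w * adjSwap i` has as
many reduced words as the dominant permutation with code lowered by one at `i`. -/
theorem exists_antitone_lehmerCode {m : ℕ} (w : Equiv.Perm (Fin (m + 1)))
    (hw : Antitone (lehmerCode w)) (i : Fin m) (hd : w i.succ < w i.castSucc) :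
    ∃ w' : Equiv.Perm (Fin (m + 1)), Antitone (lehmerCode w') ∧
      (∀ j, lehmerCode w' j + (if j = i.castSucc then 1 else 0) = lehmerCode w j) ∧
      reducedCount (w * adjSwap i) = reducedCount w' := by
  obtain ⟨s, his, hws, hmax⟩ : ∃ s, i.castSucc < s ∧ w s < w i.castSucc ∧
      ∀ j, i.castSucc < j → w j < w i.castSucc → w j ≤ w s := by
    obtain ⟨s, hs, hs'⟩ := Finset.exists_max_image
      (Finset.univ.filter fun j => i.castSucc < j ∧ w j < w i.castSucc) w
      ⟨i.succ, Finset.mem_filter.2 ⟨Finset.mem_univ _, Fin.castSucc_lt_succ, hd⟩⟩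
    obtain ⟨-, h1, h2⟩ := Finset.mem_filter.1 hs
    exact ⟨s, h1, h2, fun j h3 h4 => hs' j (Finset.mem_filter.2 ⟨Finset.mem_univ _, h3, h4⟩)⟩
  have hcode := lehmerCode_mul_swap w his hws hmax
  refine ⟨w * Equiv.swap i.castSucc s, ?_, hcode, ?_⟩
  · rw [Fin.antitone_iff_succ_le]
    intro j
    have h1 := hcode j.castSucc
    have h2 := hcode j.succ
    have h3 := hw (Fin.castSucc_lt_succ (i := j)).le
    have h4 := lehmerCode_succ_lt w i hd
    by_cases hj : j = i
    · subst hj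
      rw [if_pos rfl] at h1
      rw [if_neg (Fin.castSucc_lt_succ).ne'] at h2
      omega
    · rw [if_neg (by simpa using hj)] at h1
      omega
  · rcases (Fin.castSucc_lt_iff_succ_le.1 his).eq_or_lt with h | h
    · rw [← h]
    set y := w * Equiv.swap i.castSucc s * adjSwap i with hy
    have hs1 : i.castSucc ≠ s := his.ne
    have hs2 : s ≠ i.succ := h.ne'
    have hab : i.castSucc ≠ i.succ := (Fin.castSucc_lt_succ).ne
    have ya : y i.castSucc = w i.succ := by
      simp [hy, adjSwap, Equiv.swap_apply_of_ne_of_ne hab.symm hs2.symm]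
    have yb : y i.succ = w s := by simp [hy, adjSwap]
    have ys : y s = w i.castSucc := by
      simp [hy, adjSwap, Equiv.swap_apply_of_ne_of_ne hs1.symm hs2]
    have hcov := isBruhatCover_iff_right w hw h hd hws hmax
    rw [← hy] at hcov
    have hwbs : w i.succ < w s := lt_of_le_of_ne (hmax _ Fin.castSucc_lt_succ hd)
      (w.injective.ne hs2.symm)
    have h0 := transitionSum_eq_zero y i.succ i.castSucc s Fin.castSucc_lt_succ
      (by rwa [ya, yb]) h (by rwa [yb, ys])
    rw [transitionSum, Finset.sum_sub_distrib, sub_eq_zero] at h0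
    rw [Finset.sum_eq_single s, Finset.sum_eq_single i.castSucc, if_pos h,
      if_pos Fin.castSucc_lt_succ, coverCount, coverCount, if_pos (((hcov s).1 h).2 rfl),
      if_pos (((hcov _).2 Fin.castSucc_lt_succ).2 rfl)] at h0
    · have e1 : y * Equiv.swap i.succ s = w * adjSwap i := by
        rw [hy]
        ext x
        simp only [Equiv.Perm.coe_mul, Function.comp_apply, adjSwap, Equiv.swap_apply_def]
        grind
      have e2 : y * Equiv.swap i.castSucc i.succ = w * Equiv.swap i.castSucc s := by
        rw [hy, mul_assoc, Equiv.swap_mul_self, mul_one]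
      rw [e1, e2] at h0
      exact_mod_cast h0
    · intro x _ hx
      split_ifs with hlt
      · rw [coverCount, if_neg]
        rwa [(hcov x).2 hlt]
      · rfl
    · simp
    · intro x _ hx
      split_ifs with hlt
      · rw [coverCount, if_neg]
        rwa [(hcov x).1 hlt]
      · rfl
    · simp

lemma sum_det_updateRow_mul {n : ℕ} (A : Matrix (Fin n) (Fin n) ℝ) (d : Fin n → ℝ) :
    ∑ i, (A.updateRow i fun j => d j * A i j).det = (∑ j, d j) * A.det := by
  have h : ∀ (i : Fin n) (σ : Equiv.Perm (Fin n)),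
      ∏ k, (A.updateRow i fun j => d j * A i j) (σ k) k = d (σ⁻¹ i) * ∏ k, A (σ k) k := by
    intro i σ
    rw [← Finset.mul_prod_erase _ _ (Finset.mem_univ (σ⁻¹ i)),
      ← Finset.mul_prod_erase Finset.univ (fun k => A (σ k) k) (Finset.mem_univ (σ⁻¹ i)),
      ← mul_assoc]
    congr 1
    · simp
    · refine Finset.prod_congr rfl fun k hk => ?_
      rw [Matrix.updateRow_ne]
      rintro rfl
      simp at hk
  simp only [Matrix.det_apply', h]
  rw [Finset.sum_comm, Finset.mul_sum]
  refine Finset.sum_congr rfl fun σ _ => ?_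
  rw [← Finset.mul_sum, ← Finset.sum_mul, Equiv.sum_comp σ⁻¹ d]
  ring

lemma sum_mul_det_vandermonde_update {n : ℕ} (v : Fin n → ℝ) :
    ∑ i, v i * (Matrix.vandermonde (Function.update v i (v i - 1))).det =
      (∑ i, v i - ∑ i : Fin n, (i : ℝ)) * (Matrix.vandermonde v).det := by
  let p : Fin n → Polynomial ℝ := fun j => descPochhammer ℝ j
  have hp : ∀ u : Fin n → ℝ, (Matrix.vandermonde u).det =
      (Matrix.of fun i j => (p j).eval (u i)).det := fun u =>
    Matrix.det_eval_matrixOfPolynomials_eq_det_vandermonde u p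
      (fun i => descPochhammer_natDegree ℝ i) (fun i => monic_descPochhammer ℝ i)
  set B : Matrix (Fin n) (Fin n) ℝ := Matrix.of fun i j => (p j).eval (v i) with hB
  have hstep : ∀ (x : ℝ) (j : ℕ), x * (descPochhammer ℝ j).eval (x - 1) =
      x * (descPochhammer ℝ j).eval x - j * (descPochhammer ℝ j).eval x := by
    intro x j
    have h1 := descPochhammer_succ_eval j x
    rw [descPochhammer_succ_left] at h1
    simp only [Polynomial.eval_mul, Polynomial.eval_X, Polynomial.eval_comp, Polynomial.eval_sub,
      Polynomial.eval_one] at h1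
    rw [h1]; ring
  have hrow : ∀ i, v i * (Matrix.vandermonde (Function.update v i (v i - 1))).det =
      v i * B.det - (B.updateRow i fun j => (j : ℝ) * B i j).det := by
    intro i
    have e1 : (Matrix.of fun k j => (p j).eval (Function.update v i (v i - 1) k)) =
        B.updateRow i fun j => (p j).eval (v i - 1) := by
      ext k j
      by_cases hk : k = i
      · subst hk; simp
      · simp [hB, Function.update_of_ne hk, Matrix.updateRow_ne hk]
    have e2 : (v i • fun j => (p j).eval (v i - 1)) =
        v i • B i + (-1 : ℝ) • fun j : Fin n => (j : ℝ) * B i j := by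
      ext j
      simp only [Pi.smul_apply, smul_eq_mul, Pi.add_apply, hB, Matrix.of_apply, p]
      rw [hstep]; ring
    rw [hp, e1, ← Matrix.det_updateRow_smul, e2, Matrix.det_updateRow_add,
      Matrix.det_updateRow_smul, Matrix.det_updateRow_smul, Matrix.updateRow_eq_self]
    ring
  rw [Finset.sum_congr rfl fun i _ => hrow i, Finset.sum_sub_distrib, ← Finset.sum_mul,
    sum_det_updateRow_mul, hp v]
  ring

/-- The strict partition `c i + (m - i)` attached to a partition `c`. -/
def strictParts {m : ℕ} (c : Fin (m + 1) → ℕ) (i : Fin (m + 1)) : ℕ := c i + (m - i)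

/-- Frobenius' formula for the number of standard tableaux of shape `c`, up to a sign depending
only on `m`. -/
noncomputable def frobeniusCount {m : ℕ} (c : Fin (m + 1) → ℕ) : ℝ :=
  ((∑ i, c i).factorial : ℝ) * (Matrix.vandermonde fun i => (strictParts c i : ℝ)).det /
    ∏ i, ((strictParts c i).factorial : ℝ)

lemma frobeniusCount_lower {m : ℕ} (c c' : Fin (m + 1) → ℕ) (a : Fin (m + 1))
    (h : ∀ j, c' j + (if j = a then 1 else 0) = c j) :
    frobeniusCount c' = ((∑ i, c i - 1).factorial : ℝ) * (strictParts c a *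
      (Matrix.vandermonde (Function.update (fun i => (strictParts c i : ℝ)) a
        (strictParts c a - 1))).det) / ∏ i, ((strictParts c i).factorial : ℝ) := by
  have hsum : ∑ i, c' i = ∑ i, c i - 1 := by
    rw [← Finset.sum_congr rfl fun j _ => h j, Finset.sum_add_distrib]
    simp
  have ha : strictParts c a = strictParts c' a + 1 := by
    have := h a
    simp only [strictParts] at *
    simp at this
    omega
  have hne : ∀ j, j ≠ a → strictParts c j = strictParts c' j := by
    intro j hj
    have := h j
    simp only [strictParts] at *
    rw [if_neg hj] at this
    omega
  have hV : (fun i => (strictParts c' i : ℝ)) = Function.update (fun i => (strictParts c i : ℝ)) a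
        (strictParts c a - 1) := by
    ext j
    by_cases hj : j = a
    · subst hj; rw [Function.update_self, ha]; push_cast; ring
    · rw [Function.update_of_ne hj, hne j hj]
  have hP : ∏ i, ((strictParts c i).factorial : ℝ) =
      strictParts c a * ∏ i, ((strictParts c' i).factorial : ℝ) := by
    rw [← Finset.mul_prod_erase _ _ (Finset.mem_univ a),
      ← Finset.mul_prod_erase Finset.univ (fun i => ((strictParts c' i).factorial : ℝ))
        (Finset.mem_univ a), ← mul_assoc]
    congr 1
    · rw [ha, Nat.factorial_succ]; push_cast; ring
    · refine Finset.prod_congr rfl fun j hj => ?_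
      rw [hne j (Finset.ne_of_mem_erase hj)]
  have h1 : (strictParts c a : ℝ) ≠ 0 := by rw [ha]; positivity
  have h2 : ∏ i, ((strictParts c' i).factorial : ℝ) ≠ 0 :=
    Finset.prod_ne_zero_iff.2 fun i _ => by positivity
  rw [frobeniusCount, hsum, hV, hP]
  field_simp

lemma frobeniusCount_zero_ne_zero (m : ℕ) :
    frobeniusCount (fun _ : Fin (m + 1) => 0) ≠ 0 := by
  refine div_ne_zero (mul_ne_zero (by positivity) (Matrix.det_vandermonde_ne_zero_iff.2 ?_))
    (Finset.prod_ne_zero_iff.2 fun i _ => by positivity)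
  intro i j hij
  simp only [strictParts, Nat.cast_inj] at hij
  ext
  omega

lemma frobeniusCount_eq_sum {m : ℕ} (c : Fin (m + 1) → ℕ) (hc : Antitone c)
    (hlast : c (Fin.last m) = 0) (hpos : ∑ i, c i ≠ 0) (c' : Fin m → Fin (m + 1) → ℕ)
    (h : ∀ i : Fin m, c i.succ < c i.castSucc →
      ∀ j, c' i j + (if j = i.castSucc then 1 else 0) = c j) :
    frobeniusCount c =
      ∑ i : Fin m, if c i.succ < c i.castSucc then frobeniusCount (c' i) else 0 := by
  have hterm : ∀ i : Fin m, (if c i.succ < c i.castSucc then frobeniusCount (c' i) else 0) =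
      ((∑ i, c i - 1).factorial : ℝ) * (strictParts c i.castSucc *
      (Matrix.vandermonde (Function.update (fun i => (strictParts c i : ℝ)) i.castSucc
        (strictParts c i.castSucc - 1))).det) / ∏ i, ((strictParts c i).factorial : ℝ) := by
    intro i
    split_ifs with hi
    · exact frobeniusCount_lower c (c' i) i.castSucc (h i hi)
    · have heq : c i.succ = c i.castSucc :=
        le_antisymm (hc (Fin.castSucc_lt_succ).le) (not_lt.1 hi)
      have : (Matrix.vandermonde (Function.update (fun i => (strictParts c i : ℝ)) i.castSucc
        (strictParts c i.castSucc - 1))).det = 0 := by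
        rw [Matrix.det_vandermonde_eq_zero_iff]
        refine ⟨i.castSucc, i.succ, ?_, (Fin.castSucc_lt_succ).ne⟩
        rw [Function.update_self, Function.update_of_ne (Fin.castSucc_lt_succ).ne']
        have : strictParts c i.castSucc = strictParts c i.succ + 1 := by
          simp only [strictParts, heq, Fin.val_castSucc, Fin.val_succ]
          have := i.2
          omega
        rw [this]; push_cast; ring
      rw [this]; simp
  have hV := sum_mul_det_vandermonde_update (fun i => (strictParts c i : ℝ))
  have hlast' : (strictParts c (Fin.last m) : ℝ) = 0 := by simp [strictParts, hlast]
  rw [Fin.sum_univ_castSucc, hlast', zero_mul, add_zero] at hV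
  have hsum : ∑ i, (strictParts c i : ℝ) - ∑ i : Fin (m + 1), (i : ℝ) = (∑ i, c i : ℕ) := by
    have e1 : ∑ i : Fin (m + 1), ((m - i : ℕ) : ℝ) = ∑ i : Fin (m + 1), (i : ℝ) := by
      rw [← Equiv.sum_comp Fin.revPerm]
      refine Finset.sum_congr rfl fun i _ => ?_
      simp only [Fin.revPerm_apply, Fin.val_rev]
      congr 1
      omega
    simp only [strictParts]
    push_cast
    rw [Finset.sum_add_distrib, e1]
    ring
  rw [hsum] at hV
  rw [Finset.sum_congr rfl fun i _ => hterm i, ← Finset.sum_div, ← Finset.mul_sum, hV,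
    frobeniusCount]
  obtain ⟨N, hN⟩ := Nat.exists_eq_succ_of_ne_zero hpos
  rw [hN, Nat.succ_eq_add_one, Nat.add_sub_cancel, Nat.factorial_succ]
  push_cast
  ring

/-- The number of reduced words of a dominant permutation. -/
theorem reducedCount_mul_frobeniusCount {m : ℕ} (w : Equiv.Perm (Fin (m + 1)))
    (hw : Antitone (lehmerCode w)) :
    reducedCount w * frobeniusCount (fun _ : Fin (m + 1) => 0) =
      frobeniusCount (lehmerCode w) := by
  obtain ⟨N, hN⟩ : ∃ N, ∑ i, lehmerCode w i = N := ⟨_, rfl⟩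
  induction N generalizing w with
  | zero =>
    have h0 : lehmerCode w = fun _ => 0 := by
      ext i
      exact (Finset.sum_eq_zero_iff.1 hN) i (Finset.mem_univ _)
    rw [sum_lehmerCode] at hN
    rw [h0, eq_one_of_invCount_eq_zero w hN, reducedCount_one]
    simp
  | succ N ih =>
    have hex : ∀ i : Fin m, ∃ w' : Equiv.Perm (Fin (m + 1)), w i.succ < w i.castSucc →
        Antitone (lehmerCode w') ∧
        (∀ j, lehmerCode w' j + (if j = i.castSucc then 1 else 0) = lehmerCode w j) ∧
        reducedCount (w * adjSwap i) = reducedCount w' := by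
      intro i
      by_cases hi : w i.succ < w i.castSucc
      · obtain ⟨w', hw'⟩ := exists_antitone_lehmerCode w hw i hi
        exact ⟨w', fun _ => hw'⟩
      · exact ⟨1, fun h => absurd h hi⟩
    choose w' hw' using hex
    have hiff : ∀ i : Fin m, lehmerCode w i.succ < lehmerCode w i.castSucc ↔
        w i.succ < w i.castSucc := by
      refine fun i => ⟨fun h => ?_, lehmerCode_succ_lt w i⟩
      by_contra! hle
      have hne : w i.castSucc ≠ w i.succ := w.injective.ne (Fin.castSucc_lt_succ).ne
      exact absurd h (lehmerCode_le_succ w i (lt_of_le_of_ne hle hne)).not_gt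
    rw [frobeniusCount_eq_sum (lehmerCode w) hw (lehmerCode_last w) (by omega)
      (fun i => lehmerCode (w' i)) (fun i hi => (hw' i ((hiff i).1 hi)).2.1),
      reducedCount_eq_sum_right w (by rw [← sum_lehmerCode]; omega), Nat.cast_sum, Finset.sum_mul]
    refine Finset.sum_congr rfl fun i _ => ?_
    by_cases hi : w i.succ < w i.castSucc
    · obtain ⟨h1, h2, h3⟩ := hw' i hi
      rw [if_pos hi, if_pos ((hiff i).2 hi), h3, ih _ h1]
      have : ∑ j, (lehmerCode (w' i) j + (if j = i.castSucc then 1 else 0)) = N + 1 := by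
        rw [Finset.sum_congr rfl fun j _ => h2 j, hN]
      rw [Finset.sum_add_distrib] at this
      simpa using this
    · rw [if_neg hi, if_neg (fun h => hi ((hiff i).1 h))]
      simp

lemma det_vandermonde_eq_prod_mul {n : ℕ} (u : Fin (n + 1) → ℝ) :
    (Matrix.vandermonde u).det = (∏ j ∈ Finset.univ.erase 0, (u j - u 0)) *
      (Matrix.vandermonde fun j : Fin n => u j.succ).det := by
  rw [Matrix.det_vandermonde, Matrix.det_vandermonde, Fin.prod_univ_succ]
  congr 1
  · refine Finset.prod_congr ?_ fun _ _ => rfl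
    ext j
    simp
  · refine Finset.prod_congr rfl fun i _ => ?_
    rw [Fin.prod_Ioi_succ]

lemma det_vandermonde_update {n : ℕ} (v : Fin (n + 1) → ℝ) (hv : Function.Injective v)
    (a : Fin (n + 1)) (x : ℝ) :
    (Matrix.vandermonde (Function.update v a x)).det =
      (Matrix.vandermonde v).det * ∏ j ∈ Finset.univ.erase a, ((v j - x) / (v j - v a)) := by
  let σ : Equiv.Perm (Fin (n + 1)) := Equiv.swap 0 a
  have hσ : ∀ u : Fin (n + 1) → ℝ, (Matrix.vandermonde u).det =
      (Equiv.Perm.sign σ : ℤ) * (Matrix.vandermonde fun j => u (σ j)).det := by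
    intro u
    have := Matrix.det_permute σ (Matrix.vandermonde fun j => u (σ j))
    rw [← this]
    congr 1
    ext i j
    simp [Matrix.vandermonde_apply, σ]
  have hprod : ∀ y : ℝ, ∏ j ∈ Finset.univ.erase (0 : Fin (n + 1)), (v (σ j) - y) =
      ∏ j ∈ Finset.univ.erase a, (v j - y) := by
    intro y
    refine Finset.prod_bij' (fun j _ => σ j) (fun j _ => σ j) ?_ ?_ ?_ ?_ ?_
    · intro j hj
      simp only [Finset.mem_erase, Finset.mem_univ, and_true] at hj ⊢
      intro h
      exact hj (by simpa [σ, Equiv.swap_apply_eq_iff] using h)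
    · intro j hj
      simp only [Finset.mem_erase, Finset.mem_univ, and_true] at hj ⊢
      intro h
      exact hj (by simpa [σ, Equiv.swap_apply_eq_iff] using h)
    · simp [σ]
    · simp [σ]
    · simp
  have h0 : σ 0 = a := by simp [σ]
  rw [hσ, hσ v, det_vandermonde_eq_prod_mul, det_vandermonde_eq_prod_mul fun j => v (σ j)]
  have htail : (fun j : Fin n => Function.update v a x (σ j.succ)) = fun j => v (σ j.succ) := by
    ext j
    rw [Function.update_of_ne]
    intro h
    rw [← h0, σ.injective.eq_iff] at h
    exact Fin.succ_ne_zero j h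
  have hhead : ∏ j ∈ Finset.univ.erase (0 : Fin (n + 1)),
      (Function.update v a x (σ j) - Function.update v a x (σ 0)) =
      ∏ j ∈ Finset.univ.erase a, (v j - x) := by
    rw [← hprod]
    refine Finset.prod_congr rfl fun j hj => ?_
    rw [h0, Function.update_self, Function.update_of_ne]
    intro h
    rw [← h0, σ.injective.eq_iff] at h
    exact (Finset.ne_of_mem_erase hj) h
  rw [htail, hhead, h0, hprod, Finset.prod_div_distrib]
  have hne : ∏ j ∈ Finset.univ.erase a, (v j - v a) ≠ 0 :=
    Finset.prod_ne_zero_iff.2 fun j hj =>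
      sub_ne_zero.2 (hv.ne (Finset.ne_of_mem_erase hj))
  field_simp

lemma strictParts_injective {m : ℕ} {c : Fin (m + 1) → ℕ} (hc : Antitone c) :
    Function.Injective fun i => (strictParts c i : ℝ) := by
  have : StrictAnti (strictParts c) := by
    intro i j hij
    have h1 := hc hij.le
    have h2 : (i : ℕ) < j := hij
    simp only [strictParts]
    omega
  exact Nat.cast_injective.comp this.injective

lemma frobeniusCount_lower_eq_mul {m : ℕ} (c c' : Fin (m + 1) → ℕ) (hc : Antitone c)
    (a : Fin (m + 1)) (h : ∀ j, c' j + (if j = a then 1 else 0) = c j) :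
    frobeniusCount c' = frobeniusCount c * (strictParts c a / (∑ i, c i : ℕ) *
      ∏ j ∈ Finset.univ.erase a, (((strictParts c j : ℝ) - strictParts c a + 1) /
        (strictParts c j - strictParts c a))) := by
  have hN : ∑ i, c i = ∑ i, c' i + 1 := by
    rw [← Finset.sum_congr rfl fun j _ => h j, Finset.sum_add_distrib]
    simp
  rw [frobeniusCount_lower c c' a h, det_vandermonde_update _ (strictParts_injective hc),
    frobeniusCount, hN, Nat.add_sub_cancel, Nat.factorial_succ]
  have : ((∑ i, c' i + 1 : ℕ) : ℝ) ≠ 0 := by positivity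
  simp only [← sub_add]
  push_cast at this ⊢
  field_simp

lemma prod_erase_eq {m : ℕ} (a : Fin (m + 1)) (f : ℕ → ℝ) :
    ∏ j ∈ Finset.univ.erase a, f j =
      (∏ s ∈ Finset.range a, f (a - 1 - s)) * ∏ s ∈ Finset.range (m - a), f (a + 1 + s) := by
  have h1 : ∏ j ∈ Finset.univ.erase a, f j =
      ∏ j : Fin (m + 1), (fun t : ℕ => if t = a then 1 else f t) j := by
    rw [← Finset.mul_prod_erase Finset.univ _ (Finset.mem_univ a)]
    simp only [if_true, one_mul]
    refine Finset.prod_congr rfl fun j hj => ?_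
    rw [if_neg]
    exact fun h => Finset.ne_of_mem_erase hj (Fin.ext h)
  have h2 : m + 1 = (a + 1) + (m - a) := by omega
  rw [h1, Fin.prod_univ_eq_prod_range (fun t : ℕ => if t = a then 1 else f t) (m + 1),
    congrArg Finset.range h2, Finset.prod_range_add, Finset.prod_range_succ]
  simp only [if_true, mul_one]
  congr 1
  · rw [← Finset.prod_range_reflect]
    refine Finset.prod_congr rfl fun s hs => ?_
    have := Finset.mem_range.1 hs
    rw [if_neg (by omega)]
  · refine Finset.prod_congr rfl fun s hs => ?_
    rw [if_neg (by omega)]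

lemma prod_odd_div_even_sq_mul_wallis (k : ℕ) :
    (∏ s ∈ Finset.range k, ((2 * s + 3 : ℝ) / (2 * s + 2))) ^ 2 * Real.Wallis.W k = 2 * k + 1 := by
  induction k with
  | zero => simp [Real.Wallis.W]
  | succ k ih =>
    rw [Finset.prod_range_succ, Real.Wallis.W_succ]
    have : ∀ p W : ℝ, p ^ 2 * W = 2 * k + 1 → (p * ((2 * k + 3) / (2 * k + 2))) ^ 2 *
        (W * ((2 * k + 2) / (2 * k + 1) * ((2 * k + 2) / (2 * k + 3)))) =
        2 * ((k + 1 : ℕ) : ℝ) + 1 := by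
      intro p W h
      have e : (p * ((2 * k + 3 : ℝ) / (2 * k + 2))) ^ 2 *
        (W * ((2 * k + 2) / (2 * k + 1) * ((2 * k + 2) / (2 * k + 3)))) =
        (p ^ 2 * W) * ((2 * k + 3) / (2 * k + 1)) := by
        field_simp
      rw [e, h]
      push_cast
      field_simp
      ring
    exact this _ _ ih

lemma prod_odd_div_even_shift (k : ℕ) :
    (∏ s ∈ Finset.range k, ((2 * s + 1 : ℝ) / (2 * s + 2))) * (2 * k + 1) =
      ∏ s ∈ Finset.range k, ((2 * s + 3 : ℝ) / (2 * s + 2)) := by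
  induction k with
  | zero => simp
  | succ k ih =>
    rw [Finset.prod_range_succ, Finset.prod_range_succ, ← ih]
    push_cast
    field_simp
    ring

/-- The code of the longest element. -/
def staircase (m : ℕ) (i : Fin (m + 1)) : ℕ := m - i

lemma staircase_antitone (m : ℕ) : Antitone (staircase m) := by
  intro i j hij
  have : (i : ℕ) ≤ j := hij
  simp only [staircase]
  omega

lemma sum_staircase (m : ℕ) : ((∑ i, staircase m i : ℕ) : ℝ) = m * (m + 1) / 2 := by
  have e : ∑ i, staircase m i = ∑ i ∈ Finset.range (m + 1), i := by
    rw [← Finset.sum_range_reflect, ← Fin.sum_univ_eq_sum_range (fun i => m + 1 - 1 - i)]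
    rfl
  have h2 := Finset.sum_range_id_mul_two (m + 1)
  rw [← e, Nat.add_sub_cancel] at h2
  have h3 : ((∑ i, staircase m i : ℕ) : ℝ) * 2 = (m + 1) * m := by exact_mod_cast h2
  linarith

lemma frobeniusCount_staircase_lower (m : ℕ) (a : Fin (m + 1)) (c' : Fin (m + 1) → ℕ)
    (h : ∀ j, c' j + (if j = a then 1 else 0) = staircase m j) :
    frobeniusCount c' = frobeniusCount (staircase m) * (2 * (m - a : ℕ) / (m * (m + 1) / 2) *
      ((∏ s ∈ Finset.range a, ((2 * s + 3 : ℝ) / (2 * s + 2))) *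
        ∏ s ∈ Finset.range (m - a), ((2 * s + 1 : ℝ) / (2 * s + 2)))) := by
  rw [frobeniusCount_lower_eq_mul _ c' (staircase_antitone m) a h, sum_staircase]
  have hl : ∀ j : Fin (m + 1), (strictParts (staircase m) j : ℝ) = 2 * m - 2 * (j : ℕ) := by
    intro j
    simp only [strictParts, staircase]
    have : (j : ℕ) ≤ m := by omega
    push_cast [this]
    ring
  have ha : (a : ℕ) ≤ m := by omega
  simp only [hl]
  rw [prod_erase_eq a fun t => ((2 * m - 2 * (t : ℝ)) - (2 * m - 2 * (a : ℕ)) + 1) /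
    ((2 * m - 2 * (t : ℝ)) - (2 * m - 2 * (a : ℕ)))]
  congr 2
  · push_cast [ha]; ring
  · congr 1
    · refine Finset.prod_congr rfl fun s hs => ?_
      have := Finset.mem_range.1 hs
      have e : ((a - 1 - s : ℕ) : ℝ) = (a : ℕ) - 1 - s := by
        rw [Nat.cast_sub (by omega), Nat.cast_sub (by omega)]; simp
      rw [e]
      congr 1 <;> ring
    · refine Finset.prod_congr rfl fun s hs => ?_
      have e : ((a + 1 + s : ℕ) : ℝ) = (a : ℕ) + 1 + s := by push_cast; ring
      rw [e, ← neg_div_neg_eq]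
      congr 1 <;> ring

lemma frobeniusCount_staircase_lower_lower {m k : ℕ} (hk : k + 1 < m) (c' c'' : Fin (m + 1) → ℕ)
    (h : ∀ j, c' j + (if (j : ℕ) = k then 1 else 0) = staircase m j)
    (h' : ∀ j, c'' j + (if (j : ℕ) = k + 1 then 1 else 0) = c' j) :
    frobeniusCount c'' = frobeniusCount (staircase m) *
      (16 / 3 * ((k + 1 : ℕ) / Real.Wallis.W (k + 1)) *
        ((m - 1 - k : ℕ) / Real.Wallis.W (m - 1 - k)) /
        ((m * (m + 1) / 2) * (m * (m + 1) / 2 - 1))) := by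
  let a : Fin (m + 1) := ⟨k, by omega⟩
  let b : Fin (m + 1) := ⟨k + 1, by omega⟩
  have hanti : Antitone c' := by
    rw [Fin.antitone_iff_succ_le]
    intro i
    have h1 := h i.castSucc
    have h2 := h i.succ
    simp only [Fin.val_castSucc, Fin.val_succ, staircase] at h1 h2
    have := i.2
    split_ifs at h1 h2 <;> omega
  have hsum : ((∑ i, c' i : ℕ) : ℝ) = m * (m + 1) / 2 - 1 := by
    rw [← sum_staircase, ← Finset.sum_congr rfl fun j _ => h j, Finset.sum_add_distrib]
    have : ∑ j : Fin (m + 1), (if (j : ℕ) = k then 1 else 0) = 1 := by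
      rw [Finset.sum_eq_single a]
      · simp [a]
      · intro j _ hj
        rw [if_neg]
        exact fun hjk => hj (Fin.ext hjk)
      · simp
    rw [this]
    push_cast
    ring
  rw [frobeniusCount_lower_eq_mul c' c'' hanti b (by
      intro j; rw [← h' j]; congr 1; exact if_congr Fin.ext_iff rfl rfl), hsum,
    frobeniusCount_staircase_lower m a c' (by
      intro j; rw [← h j]; congr 1; exact if_congr Fin.ext_iff rfl rfl)]
  have hl : ∀ j : Fin (m + 1), (strictParts c' j : ℝ) =
      (fun t : ℕ => 2 * (m : ℝ) - 2 * t - if t = k then 1 else 0) j := by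
    intro j
    have hj := h j
    have : (j : ℕ) ≤ m := by omega
    simp only [strictParts, staircase] at hj ⊢
    have e : (c' j : ℝ) + (if (j : ℕ) = k then 1 else 0) = m - (j : ℕ) := by
      rw [← Nat.cast_sub this, ← hj]
      push_cast
      rfl
    push_cast [this]
    linarith
  obtain ⟨T, rfl⟩ : ∃ T, m = k + 1 + T := ⟨m - (k + 1), by omega⟩
  have e1 : k + 1 + T - 1 - k = T := by omega
  have e2 : k + 1 + T - k = T + 1 := by omega
  have e3 : k + 1 + T - (k + 1) = T := by omega
  have hprod : ∏ j ∈ Finset.univ.erase b, (((strictParts c' j : ℝ) - strictParts c' b + 1) /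
        (strictParts c' j - strictParts c' b)) =
      4 / 3 * (∏ s ∈ Finset.range (k + 1), ((2 * s + 3 : ℝ) / (2 * s + 2))) *
        ∏ s ∈ Finset.range T, ((2 * s + 1 : ℝ) / (2 * s + 2)) := by
    simp only [hl]
    rw [prod_erase_eq b fun t => ((2 * ((k + 1 + T : ℕ) : ℝ) - 2 * t - if t = k then 1 else 0) -
      (2 * ((k + 1 + T : ℕ) : ℝ) - 2 * (b : ℕ) - if (b : ℕ) = k then 1 else 0) + 1) /
      ((2 * ((k + 1 + T : ℕ) : ℝ) - 2 * t - if t = k then 1 else 0) -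
      (2 * ((k + 1 + T : ℕ) : ℝ) - 2 * (b : ℕ) - if (b : ℕ) = k then 1 else 0))]
    simp only [b, e3]
    congr 1
    · rw [Finset.prod_range_succ', Finset.prod_range_succ']
      have : ∀ s ∈ Finset.range k, (k + 1 - 1 - (s + 1) : ℕ) ≠ k ∧
          ((k + 1 - 1 - (s + 1) : ℕ) : ℝ) = k - (s + 1) := by
        intro s hs
        have := Finset.mem_range.1 hs
        refine ⟨by omega, ?_⟩
        rw [Nat.add_sub_cancel, Nat.cast_sub (by omega)]
        push_cast
        ring
      rw [Finset.prod_congr rfl fun s hs => by rw [(this s hs).2, if_neg (this s hs).1]]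
      rw [if_neg (by omega), if_pos (by omega)]
      rw [mul_comm (4 / 3 : ℝ), mul_assoc]
      congr 1
      · refine Finset.prod_congr rfl fun s hs => ?_
        push_cast
        congr 1 <;> ring
      · simp
        ring_nf
    · refine Finset.prod_congr rfl fun s hs => ?_
      rw [if_neg (by omega), if_neg (by omega), ← neg_div_neg_eq]
      push_cast
      congr 1 <;> ring
  rw [hprod]
  have hb : (strictParts c' b : ℝ) = 2 * T := by
    rw [hl]
    simp [b]
    ring
  rw [hb]
  simp only [a, e1, e2]
  have w1 := prod_odd_div_even_sq_mul_wallis (k + 1)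
  have w2 := prod_odd_div_even_sq_mul_wallis T
  have w3 := prod_odd_div_even_shift T
  have p1 := Real.Wallis.W_pos (k + 1)
  have p2 := Real.Wallis.W_pos T
  rw [← w3] at w2
  rw [Finset.prod_range_succ] at w1
  rw [Finset.prod_range_succ _ T, Finset.prod_range_succ _ k]
  clear w3 hprod hl hb
  generalize (∏ s ∈ Finset.range k, ((2 * s + 3 : ℝ) / (2 * s + 2))) = A at *
  generalize (∏ s ∈ Finset.range T, ((2 * s + 1 : ℝ) / (2 * s + 2))) = C at *
  generalize Real.Wallis.W (k + 1) = W1 at *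
  generalize Real.Wallis.W T = W2 at *
  have hA : A ≠ 0 := by
    rintro rfl
    have : (0 : ℝ) < 2 * ((k + 1 : ℕ) : ℝ) + 1 := by positivity
    simp at w1
    push_cast at this
    linarith
  have hC : C ≠ 0 := by
    rintro rfl
    have : (0 : ℝ) < 2 * (T : ℝ) + 1 := by positivity
    simp at w2
    linarith
  have q1 : W1 = (2 * ((k + 1 : ℕ) : ℝ) + 1) / (A * ((2 * k + 3) / (2 * k + 2))) ^ 2 :=
    eq_div_of_mul_eq (by positivity) (by linarith)
  have q2 : W2 = (2 * (T : ℝ) + 1) / (C * (2 * T + 1)) ^ 2 :=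
    eq_div_of_mul_eq (by positivity) (by linarith)
  rw [q1, q2]
  have hN : ((k + 1 + T : ℕ) : ℝ) * ((k + 1 + T : ℕ) + 1) / 2 - 1 ≠ 0 := by
    have hT : (1 : ℝ) ≤ T := by exact_mod_cast (by omega : 1 ≤ T)
    have hk0 : (0 : ℝ) ≤ k := by positivity
    push_cast
    nlinarith
  rw [mul_assoc]
  congr 1
  generalize ((k + 1 + T : ℕ) : ℝ) * ((k + 1 + T : ℕ) + 1) / 2 - 1 = D at *
  have hm : ((k + 1 + T : ℕ) : ℝ) ≠ 0 := by positivity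
  push_cast at hm ⊢
  field_simp
  ring

lemma lehmerCode_longest (m : ℕ) : lehmerCode (w₀ (m + 1)) = staircase m := by
  funext i
  have : (Finset.univ.filter fun j => i < j ∧ w₀ (m + 1) j < w₀ (m + 1) i) = Finset.Ioi i := by
    ext j
    simp [w₀]
  rw [lehmerCode, this, Fin.card_Ioi, staircase]
  omega

lemma invCount_longest (m : ℕ) : (invCount (w₀ (m + 1)) : ℝ) = m * (m + 1) / 2 := by
  rw [← sum_lehmerCode, lehmerCode_longest, sum_staircase]

lemma longest_inv (n : ℕ) : (w₀ n)⁻¹ = w₀ n := rfl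

lemma longest_mul_adjSwap_rev {m : ℕ} (i : Fin m) :
    w₀ (m + 1) * adjSwap i.rev = adjSwap i * w₀ (m + 1) := by
  rw [← mul_inv_eq_iff_eq_mul, adjSwap, ← Equiv.swap_apply_apply]
  simp [adjSwap, w₀, Fin.rev_castSucc, Fin.rev_succ, Equiv.swap_comm]

lemma isReducedWordFor_longest_iff {m : ℕ} (h : reducedCount (w₀ (m + 1)) ≠ 0) (l : List ℕ) :
    IsReducedWordFor (m + 1) (w₀ (m + 1)) l ↔
      l ∈ wordsOfLength (invCount (w₀ (m + 1))) (w₀ (m + 1)) := by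
  rw [mem_wordsOfLength]
  constructor
  · rintro ⟨h1, h2⟩
    obtain ⟨l', hl'⟩ := Finset.card_ne_zero.1 h
    rw [mem_wordsOfLength] at hl'
    have := h2 l' hl'.2
    have := invCount_le_of_isWordFor _ _ h1
    exact ⟨by omega, h1⟩
  · rintro ⟨h1, h2⟩
    exact ⟨h2, fun l' hl' => h1 ▸ invCount_le_of_isWordFor _ _ hl'⟩

lemma frobeniusCount_staircase_ne_zero (m : ℕ) : frobeniusCount (staircase m) ≠ 0 := by
  rw [frobeniusCount]
  refine div_ne_zero (mul_ne_zero (by positivity) ?_) ?_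
  · exact Matrix.det_vandermonde_ne_zero_iff.2 (strictParts_injective (staircase_antitone m))
  · exact Finset.prod_ne_zero_iff.2 fun i _ => by positivity

lemma reducedCount_longest_mul (m : ℕ) :
    (reducedCount (w₀ (m + 1)) : ℝ) * frobeniusCount (fun _ : Fin (m + 1) => 0) =
      frobeniusCount (staircase m) := by
  rw [← lehmerCode_longest]
  exact reducedCount_mul_frobeniusCount _ (lehmerCode_longest m ▸ staircase_antitone m)

lemma reducedCount_longest_ne_zero (m : ℕ) : reducedCount (w₀ (m + 1)) ≠ 0 := by
  intro h
  have := reducedCount_longest_mul m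
  rw [h, Nat.cast_zero, zero_mul] at this
  exact frobeniusCount_staircase_ne_zero m this.symm

/-- Moving the first letter `i` of a word to the end, turned into `n - i`; this acts on the reduced
words of the longest element of `S_n`. -/
def rotateWord (n : ℕ) : List ℕ → List ℕ
  | [] => []
  | i :: l => l ++ [n - i]

lemma length_rotateWord (n : ℕ) (l : List ℕ) : (rotateWord n l).length = l.length := by
  cases l <;> simp [rotateWord]

lemma isWordFor_rotateWord {m : ℕ} {l : List ℕ} (h : IsWordFor (m + 1) (w₀ (m + 1)) l) :
    IsWordFor (m + 1) (w₀ (m + 1)) (rotateWord (m + 1) l) := by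
  cases l with
  | nil => exact h
  | cons a l =>
    have ha := h.1 a (by simp)
    obtain ⟨i, rfl⟩ : ∃ i : Fin m, a = i + 1 := ⟨⟨a - 1, by omega⟩, by simp; omega⟩
    rw [isWordFor_cons] at h
    have e : m + 1 - (i + 1 : ℕ) = (i.rev : ℕ) + 1 := by simp [Fin.val_rev]; omega
    simp only [rotateWord, e]
    refine ⟨?_, ?_⟩
    · intro x hx
      rcases List.mem_append.1 hx with hx | hx
      · exact h.1 x hx
      · rw [List.mem_singleton.1 hx]
        have := i.rev.2
        omega
    · have h2 := h.2
      rw [wordProd] at h2 ⊢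
      rw [List.map_append, List.prod_append, h2, List.map_singleton, List.prod_singleton,
        simpleRefl_succ, mul_assoc, longest_mul_adjSwap_rev, Equiv.swap_mul_self_mul]

lemma rotateWord_injOn {n : ℕ} {l l' : List ℕ} (h : ∀ i ∈ l, i ≤ n) (h' : ∀ i ∈ l', i ≤ n)
    (e : rotateWord n l = rotateWord n l') : l = l' := by
  cases l with
  | nil =>
    cases l' with
    | nil => rfl
    | cons a l' => simp [rotateWord] at e
  | cons a l =>
    cases l' with
    | nil => simp [rotateWord] at e
    | cons a' l' =>
      have h1 := h a (by simp)
      have h2 := h' a' (by simp)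
      have := List.append_inj' e rfl
      simp only [List.cons.injEq, and_true] at this
      rw [this.1, show a = a' by omega]

lemma getD_rotateWord (n : ℕ) (l : List ℕ) (k : ℕ) (hk : k + 1 < l.length) :
    (rotateWord n l).getD k 0 = l.getD (k + 1) 0 := by
  cases l with
  | nil => simp at hk
  | cons a l =>
    simp only [List.length_cons, add_lt_add_iff_right] at hk
    simp [rotateWord, List.getD, List.getElem?_append_left hk, hk]

/-- The letters in positions `k` and `k + 1` form a noncommuting pair. -/
def NoncommAt (k : ℕ) (l : List ℕ) : Prop :=
  |(l.getD k 0 : ℤ) - (l.getD (k + 1) 0 : ℤ)| = 1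

lemma card_filter_noncommAt {m : ℕ} (k : ℕ) (hk : k + 1 < invCount (w₀ (m + 1))) :
    ((wordsOfLength (invCount (w₀ (m + 1))) (w₀ (m + 1))).filter (NoncommAt k)).card =
      ((wordsOfLength (invCount (w₀ (m + 1))) (w₀ (m + 1))).filter (NoncommAt 0)).card := by
  induction k with
  | zero => rfl
  | succ k ih =>
    rw [← ih (by omega)]
    set R := wordsOfLength (invCount (w₀ (m + 1))) (w₀ (m + 1)) with hR
    have hinj : Set.InjOn (rotateWord (m + 1)) R := by
      intro l hl l' hl' e
      rw [Finset.mem_coe, hR, mem_wordsOfLength] at hl hl'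
      refine rotateWord_injOn (fun i hi => ?_) (fun i hi => ?_) e
      · exact (hl.2.1 i hi).2.trans (by omega)
      · exact (hl'.2.1 i hi).2.trans (by omega)
    have himg : R.image (rotateWord (m + 1)) = R := by
      refine Finset.eq_of_subset_of_card_le ?_ (Finset.card_image_of_injOn hinj).ge
      refine Finset.image_subset_iff.2 fun l hl => ?_
      rw [hR, mem_wordsOfLength] at hl ⊢
      exact ⟨by rw [length_rotateWord, hl.1], isWordFor_rotateWord hl.2⟩
    conv_rhs => rw [← himg, Finset.filter_image]
    rw [Finset.card_image_of_injOn (hinj.mono fun l hl => (Finset.mem_filter.1 hl).1)]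
    congr 1
    refine Finset.filter_congr fun l hl => ?_
    rw [hR, mem_wordsOfLength] at hl
    rw [NoncommAt, NoncommAt, getD_rotateWord _ _ _ (by omega), getD_rotateWord _ _ _ (by omega)]

lemma sum_noncommCount (m : ℕ) :
    ∑ l ∈ wordsOfLength (invCount (w₀ (m + 1))) (w₀ (m + 1)), noncommCount l =
      (invCount (w₀ (m + 1)) - 1) *
        ((wordsOfLength (invCount (w₀ (m + 1))) (w₀ (m + 1))).filter (NoncommAt 0)).card := by
  have : ∀ l ∈ wordsOfLength (invCount (w₀ (m + 1))) (w₀ (m + 1)), noncommCount l =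
      ∑ k ∈ Finset.range (invCount (w₀ (m + 1)) - 1), if NoncommAt k l then 1 else 0 := by
    intro l hl
    rw [noncommCount, ((mem_wordsOfLength _ _ _).1 hl).1, Finset.card_filter]
    exact Finset.sum_congr rfl fun k _ => if_congr Iff.rfl rfl rfl
  rw [Finset.sum_congr rfl this, Finset.sum_comm]
  simp only [← Finset.card_filter]
  rw [Finset.sum_congr rfl fun k hk => card_filter_noncommAt k
    (by have := Finset.mem_range.1 hk; omega), Finset.sum_const, Finset.card_range, smul_eq_mul]

lemma expectedStat_noncommCount (m : ℕ) :
    expectedStat (m + 1) noncommCount = ((invCount (w₀ (m + 1)) - 1 : ℕ) : ℝ) *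
      ((wordsOfLength (invCount (w₀ (m + 1))) (w₀ (m + 1))).filter (NoncommAt 0)).card /
        reducedCount (w₀ (m + 1)) := by
  have h : {l | IsReducedWordFor (m + 1) (w₀ (m + 1)) l} =
      ((wordsOfLength (invCount (w₀ (m + 1))) (w₀ (m + 1)) : Finset (List ℕ)) : Set (List ℕ)) := by
    ext l
    exact isReducedWordFor_longest_iff (reducedCount_longest_ne_zero m) l
  have h2 : Nat.card {l : List ℕ // IsReducedWordFor (m + 1) (w₀ (m + 1)) l} =
      reducedCount (w₀ (m + 1)) := by
    rw [Nat.subtype_card _ fun l =>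
      (isReducedWordFor_longest_iff (reducedCount_longest_ne_zero m) l).symm, reducedCount]
  rw [expectedStat, h2, h, finsum_mem_coe_finset, ← Nat.cast_mul, ← sum_noncommCount]
  push_cast
  rfl

lemma card_filter_wordsOfLength_succ {m : ℕ} (k : ℕ) (w : Equiv.Perm (Fin (m + 1)))
    (p : List ℕ → Prop) :
    ((wordsOfLength (k + 1) w).filter p).card =
      ∑ i : Fin m, ((wordsOfLength k (adjSwap i * w)).filter
        fun l => p ((i + 1 : ℕ) :: l)).card := by
  rw [wordsOfLength, Finset.filter_biUnion, Finset.card_biUnion]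
  · refine Finset.sum_congr rfl fun i _ => ?_
    rw [Finset.filter_image, Finset.card_image_of_injective _ List.cons_injective]
  · intro i _ j _ hij
    rw [Function.onFun, Finset.disjoint_left]
    simp only [Finset.mem_filter, Finset.mem_image, not_and, forall_exists_index,
      and_imp]
    rintro _ l _ rfl _ l' _ h
    simp only [List.cons.injEq, add_left_inj] at h
    exact absurd (Fin.ext h.1.symm) hij

lemma card_filter_noncommAt_zero {m : ℕ} (k : ℕ) (w : Equiv.Perm (Fin (m + 1))) :
    ((wordsOfLength (k + 2) w).filter (NoncommAt 0)).card =
      ∑ i : Fin m, ∑ j : Fin m, if |((i : ℕ) : ℤ) - (j : ℕ)| = 1 then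
        (wordsOfLength k (adjSwap j * (adjSwap i * w))).card else 0 := by
  rw [card_filter_wordsOfLength_succ]
  refine Finset.sum_congr rfl fun i _ => ?_
  rw [card_filter_wordsOfLength_succ]
  refine Finset.sum_congr rfl fun j _ => ?_
  have : ∀ l, NoncommAt 0 ((i + 1 : ℕ) :: (j + 1 : ℕ) :: l) ↔ |((i : ℕ) : ℤ) - (j : ℕ)| = 1 := by
    intro l
    simp [NoncommAt]
  simp only [this, Finset.filter_const, apply_ite Finset.card, Finset.card_empty]

lemma sum_adjacent_pairs {p : ℕ} (f : Fin (p + 1) → Fin (p + 1) → ℝ) :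
    (∑ i : Fin (p + 1), ∑ j : Fin (p + 1), if |((i : ℕ) : ℤ) - (j : ℕ)| = 1 then f i j else 0) =
      ∑ k : Fin p, (f k.castSucc k.succ + f k.succ k.castSucc) := by
  have key : ∀ g : Fin (p + 1) → Fin (p + 1) → ℝ,
      (∑ i : Fin (p + 1), ∑ j : Fin (p + 1), if (j : ℕ) = i + 1 then g i j else 0) = ∑ k : Fin p, g k.castSucc k.succ := by
    intro g
    rw [Fin.sum_univ_castSucc]
    have hlast : (∑ j : Fin (p + 1), if (j : ℕ) = Fin.last p + 1 then g (Fin.last p) j else 0) =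
        0 := by
      refine Finset.sum_eq_zero fun j _ => if_neg ?_
      have := j.2
      simp only [Fin.val_last]
      omega
    rw [hlast, add_zero]
    refine Finset.sum_congr rfl fun k _ => ?_
    rw [Finset.sum_eq_single k.succ]
    · simp
    · intro j _ hj
      refine if_neg fun h => hj (Fin.ext ?_)
      simpa using h
    · simp
  rw [Finset.sum_add_distrib, ← key f, ← key fun i j => f j i, Finset.sum_comm
    (f := fun i j : Fin (p + 1) => if (j : ℕ) = i + 1 then f j i else 0),
    ← Finset.sum_add_distrib]
  refine Finset.sum_congr rfl fun i _ => ?_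
  rw [← Finset.sum_add_distrib]
  refine Finset.sum_congr rfl fun j _ => ?_
  rcases lt_trichotomy ((j : ℕ)) (i + 1) with h | h | h
  · by_cases h2 : (i : ℕ) = j + 1
    · rw [if_pos, if_neg, if_pos h2, zero_add]
      · omega
      · rw [h2]; simp
    · rw [if_neg, if_neg, if_neg h2, zero_add]
      · omega
      · rw [abs_eq (by norm_num)]
        omega
  · rw [if_pos, if_pos h, if_neg, add_zero]
    · omega
    · rw [h]; simp
  · rw [if_neg, if_neg, if_neg, zero_add]
    · omega
    · omega
    · rw [abs_eq (by norm_num)]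
      omega

lemma card_wordsOfLength_adjSwap_adjSwap {m : ℕ} (k : ℕ) (i j : Fin m)
    (hk : k + 2 = invCount (w₀ (m + 1))) (hij : i ≠ j) :
    ∃ c' c'' : Fin (m + 1) → ℕ,
      (∀ t, c' t + (if (t : ℕ) = i then 1 else 0) = staircase m t) ∧
      (∀ t, c'' t + (if (t : ℕ) = j then 1 else 0) = c' t) ∧
      ((wordsOfLength k (adjSwap j * (adjSwap i * w₀ (m + 1)))).card : ℝ) *
        frobeniusCount (fun _ : Fin (m + 1) => 0) = frobeniusCount c'' := by
  set u := w₀ (m + 1) * adjSwap i with hu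
  have hcode : ∀ t, lehmerCode u t + (if (t : ℕ) = i then 1 else 0) = staircase m t := by
    intro t
    rw [← lehmerCode_longest, ← lehmerCode_mul_swap (w₀ (m + 1)) (i := i.castSucc) (s := i.succ)
      Fin.castSucc_lt_succ (by simp [w₀]) (by
        intro s hs _
        simpa [w₀] using Fin.castSucc_lt_iff_succ_le.1 hs)]
    congr 1
    exact if_congr (by simp [Fin.ext_iff]) rfl rfl
  have hdesc0 : w₀ (m + 1) i.succ < w₀ (m + 1) i.castSucc := by simp [w₀]
  have hanti : Antitone (lehmerCode u) := by
    rw [Fin.antitone_iff_succ_le]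
    intro t
    have h1 := hcode t.castSucc
    have h2 := hcode t.succ
    simp only [Fin.val_castSucc, Fin.val_succ, staircase] at h1 h2
    have := t.2
    split_ifs at h1 h2 <;> omega
  have hdesc : u j.succ < u j.castSucc := by
    have hne : (i : ℕ) ≠ j := fun h => hij (Fin.ext h)
    have hij' : ∀ x : Fin (m + 1), (u x : ℕ) =
        m - (if (x : ℕ) = i then (i : ℕ) + 1 else if (x : ℕ) = i + 1 then (i : ℕ) else x) := by
      intro x
      simp only [hu, Equiv.Perm.mul_apply, w₀, Fin.revPerm_apply, Fin.val_rev, adjSwap,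
        Equiv.swap_apply_def, Fin.ext_iff, Fin.val_castSucc, Fin.val_succ]
      split_ifs <;> simp
    rw [Fin.lt_def, hij', hij']
    simp only [Fin.val_castSucc, Fin.val_succ]
    have := i.2
    have := j.2
    split_ifs <;> omega
  obtain ⟨v, hv1, hv2, hv3⟩ := exists_antitone_lehmerCode u hanti j hdesc
  refine ⟨lehmerCode u, lehmerCode v, hcode, fun t => ?_, ?_⟩
  · rw [← hv2 t]
    congr 1
    exact if_congr (by simp [Fin.ext_iff]) rfl rfl
  · rw [← reducedCount_mul_frobeniusCount v hv1, ← hv3]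
    congr 2
    have hinv : (adjSwap j * (adjSwap i * w₀ (m + 1)))⁻¹ = u * adjSwap j := by
      rw [adjSwap_mul_inv, adjSwap_mul_inv, longest_inv]
    have hlen : invCount (u * adjSwap j) = k := by
      have h1 := invCount_mul_adjSwap_of_desc u j hdesc
      have h2 := invCount_mul_adjSwap_of_desc _ i hdesc0
      rw [← hu] at h2
      omega
    rw [← card_wordsOfLength_inv, hinv, reducedCount, hlen]

lemma card_noncommAt_zero_div (p : ℕ) (hp : 1 ≤ p) :
    (((wordsOfLength (invCount (w₀ (p + 2))) (w₀ (p + 2))).filter (NoncommAt 0)).card : ℝ) =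
      reducedCount (w₀ (p + 2)) * ∑ k ∈ Finset.range p, 2 *
        (16 / 3 * ((k + 1 : ℕ) / Real.Wallis.W (k + 1)) * ((p - k : ℕ) / Real.Wallis.W (p - k)) /
          (((p + 1 : ℕ) * ((p + 1 : ℕ) + 1) / 2) * ((p + 1 : ℕ) * ((p + 1 : ℕ) + 1) / 2 - 1))) := by
  obtain ⟨K, hK⟩ : ∃ K, K + 2 = invCount (w₀ (p + 2)) := by
    refine ⟨invCount (w₀ (p + 2)) - 2, Nat.sub_add_cancel ?_⟩
    have h := invCount_longest (p + 1)
    have hp' : (1 : ℝ) ≤ p := by exact_mod_cast hp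
    have : (2 : ℝ) ≤ invCount (w₀ (p + 2)) := by
      rw [h]
      push_cast
      nlinarith
    exact_mod_cast this
  refine mul_right_cancel₀ (frobeniusCount_zero_ne_zero (p + 1)) ?_
  rw [mul_right_comm, reducedCount_longest_mul, ← hK, card_filter_noncommAt_zero, Finset.mul_sum]
  push_cast
  rw [sum_adjacent_pairs fun i j : Fin (p + 1) =>
    ((wordsOfLength K (adjSwap j * (adjSwap i * w₀ (p + 2)))).card : ℝ), Finset.sum_mul,
    ← Fin.sum_univ_eq_sum_range (fun k => frobeniusCount (staircase (p + 1)) * (2 *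
        (16 / 3 * (((k : ℝ) + 1) / Real.Wallis.W (k + 1)) * ((p - k : ℕ) / Real.Wallis.W (p - k)) /
          ((((p : ℝ) + 1) * ((p : ℝ) + 1 + 1) / 2) * (((p : ℝ) + 1) * ((p : ℝ) + 1 + 1) / 2 - 1)))))]
  refine Finset.sum_congr rfl fun k _ => ?_
  have hne : k.castSucc ≠ k.succ := Fin.castSucc_lt_succ.ne
  obtain ⟨c1, d1, h1, h1', e1⟩ := card_wordsOfLength_adjSwap_adjSwap K _ _ hK hne
  obtain ⟨c2, d2, h2, h2', e2⟩ := card_wordsOfLength_adjSwap_adjSwap K _ _ hK hne.symm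
  have hd : d2 = d1 := by
    funext t
    have a1 := h1 t
    have a2 := h2 t
    have a3 := h1' t
    have a4 := h2' t
    omega
  rw [add_mul, e1, e2, hd, frobeniusCount_staircase_lower_lower (k := k) (by have := k.2; omega) c1
    d1 h1 h1', show p + 1 - 1 - (k : ℕ) = p - k by omega]
  push_cast
  ring

lemma expectedStat_noncommCount_eq (p : ℕ) (hp : 1 ≤ p) :
    expectedStat (p + 2) noncommCount = 64 / (3 * ((p + 1) * (p + 2))) *
      ∑ k ∈ Finset.range p, ((k + 1 : ℕ) / Real.Wallis.W (k + 1)) *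
        ((p - k : ℕ) / Real.Wallis.W (p - k)) := by
  have hR : (reducedCount (w₀ (p + 2)) : ℝ) ≠ 0 :=
    Nat.cast_ne_zero.2 (reducedCount_longest_ne_zero (p + 1))
  have hN := invCount_longest (p + 1)
  have hp' : (1 : ℝ) ≤ p := by exact_mod_cast hp
  have hN1 : (0 : ℝ) < (p + 1 : ℕ) * ((p + 1 : ℕ) + 1) / 2 - 1 := by
    push_cast
    nlinarith
  have hN2 : ((invCount (w₀ (p + 2)) - 1 : ℕ) : ℝ) = (p + 1 : ℕ) * ((p + 1 : ℕ) + 1) / 2 - 1 := by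
    rw [Nat.cast_sub, hN, Nat.cast_one]
    have : (1 : ℝ) ≤ invCount (w₀ (p + 2)) := by linarith
    exact_mod_cast this
  rw [expectedStat_noncommCount, card_noncommAt_zero_div p hp, hN2, ← mul_assoc, mul_comm _
    (reducedCount (w₀ (p + 2)) : ℝ), mul_assoc, mul_div_cancel_left₀ _ hR, Finset.mul_sum,
    Finset.mul_sum]
  refine Finset.sum_congr rfl fun k _ => ?_
  generalize ((k + 1 : ℕ) : ℝ) / Real.Wallis.W (k + 1) = x
  generalize ((p - k : ℕ) : ℝ) / Real.Wallis.W (p - k) = y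
  generalize hD : ((p + 1 : ℕ) : ℝ) * ((p + 1 : ℕ) + 1) / 2 - 1 = D at hN1
  push_cast
  field_simp
  ring

lemma le_div_wallis (k : ℕ) : 2 / Real.pi * k ≤ k / Real.Wallis.W k := by
  have h := Real.Wallis.W_le k
  have h0 := Real.Wallis.W_pos k
  have hpi := Real.pi_pos
  rw [le_div_iff₀ h0, div_mul_eq_mul_div, div_mul_eq_mul_div, div_le_iff₀ hpi]
  have hk : (0 : ℝ) ≤ k := by positivity
  nlinarith [mul_le_mul_of_nonneg_left h hk]

lemma div_wallis_le (k : ℕ) : k / Real.Wallis.W k ≤ 2 / Real.pi * (k + 1 / 2) := by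
  have h := Real.Wallis.le_W k
  have h0 := Real.Wallis.W_pos k
  have hpi := Real.pi_pos
  rw [div_le_iff₀ h0]
  have hk : (0 : ℝ) ≤ k := by positivity
  calc (k : ℝ) ≤ 2 / Real.pi * (k + 1 / 2) * ((2 * k + 1) / (2 * k + 2) * (Real.pi / 2)) := by
        have e : 2 / Real.pi * ((k : ℝ) + 1 / 2) * ((2 * k + 1) / (2 * k + 2) * (Real.pi / 2)) =
            (2 * k + 1) ^ 2 / (2 * (2 * k + 2)) := by
          field_simp
        rw [e, le_div_iff₀ (by positivity)]
        nlinarith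
    _ ≤ _ := by gcongr

lemma sum_mul_reflect (p : ℕ) :
    ∑ k ∈ Finset.range p, ((k + 1 : ℕ) : ℝ) * (p - k : ℕ) = p * (p + 1) * (p + 2) / 6 := by
  induction p with
  | zero => simp
  | succ p ih =>
    have e : ∀ k ∈ Finset.range p, ((k + 1 : ℕ) : ℝ) * (p + 1 - k : ℕ) =
        ((k + 1 : ℕ) : ℝ) * (p - k : ℕ) + (k + 1 : ℕ) := by
      intro k hk
      rw [Nat.sub_add_comm (Finset.mem_range.1 hk).le]
      push_cast
      ring
    have e2 : ∀ p : ℕ, ∑ k ∈ Finset.range p, ((k + 1 : ℕ) : ℝ) = p * (p + 1) / 2 := by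
      intro p
      induction p with
      | zero => simp
      | succ p ih =>
        rw [Finset.sum_range_succ, ih]
        push_cast
        ring
    rw [Finset.sum_range_succ, Finset.sum_congr rfl e, Finset.sum_add_distrib, ih, e2,
      Nat.add_sub_cancel_left]
    push_cast
    ring

lemma sum_half_mul_reflect (p : ℕ) :
    ∑ k ∈ Finset.range p, (((k + 1 : ℕ) : ℝ) + 1 / 2) * ((p - k : ℕ) + 1 / 2) =
      p * (p + 1) * (p + 2) / 6 + p * (p + 1) / 2 + p / 4 := by
  have e : ∀ k ∈ Finset.range p, (((k + 1 : ℕ) : ℝ) + 1 / 2) * ((p - k : ℕ) + 1 / 2) =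
      ((k + 1 : ℕ) : ℝ) * (p - k : ℕ) + ((p + 1) / 2 + 1 / 4) := by
    intro k hk
    rw [Nat.cast_sub (Finset.mem_range.1 hk).le]
    push_cast
    ring
  rw [Finset.sum_congr rfl e, Finset.sum_add_distrib, sum_mul_reflect, Finset.sum_const,
    Finset.card_range, nsmul_eq_mul]
  ring

lemma le_expectedStat_noncommCount_div (p : ℕ) (hp : 1 ≤ p) :
    128 / (9 * Real.pi ^ 2) * (1 - 2 / ((p : ℝ) + 2)) ≤
      expectedStat (p + 2) noncommCount / ((p + 2 : ℕ) : ℝ) := by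
  have hpi := Real.pi_pos
  rw [expectedStat_noncommCount_eq p hp]
  have h : (2 / Real.pi) ^ 2 * (p * (p + 1) * (p + 2) / 6) ≤
      ∑ k ∈ Finset.range p, ((k + 1 : ℕ) / Real.Wallis.W (k + 1)) *
        ((p - k : ℕ) / Real.Wallis.W (p - k)) := by
    rw [← sum_mul_reflect, Finset.mul_sum]
    refine Finset.sum_le_sum fun k _ => ?_
    rw [pow_two, mul_mul_mul_comm]
    exact mul_le_mul (le_div_wallis _) (le_div_wallis _) (by positivity)
      (div_nonneg (by positivity) (Real.Wallis.W_pos _).le)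
  calc 128 / (9 * Real.pi ^ 2) * (1 - 2 / ((p : ℝ) + 2)) =
        64 / (3 * ((p + 1) * (p + 2))) *
          ((2 / Real.pi) ^ 2 * (p * (p + 1) * (p + 2) / 6)) / ((p + 2 : ℕ) : ℝ) := by
        push_cast
        field_simp
        ring
    _ ≤ _ := by gcongr

lemma expectedStat_noncommCount_div_le (p : ℕ) (hp : 1 ≤ p) :
    expectedStat (p + 2) noncommCount / ((p + 2 : ℕ) : ℝ) ≤
      128 / (9 * Real.pi ^ 2) * (1 + 3 / ((p : ℝ) + 2)) := by
  have hpi := Real.pi_pos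
  rw [expectedStat_noncommCount_eq p hp]
  have h : ∑ k ∈ Finset.range p, ((k + 1 : ℕ) / Real.Wallis.W (k + 1)) *
        ((p - k : ℕ) / Real.Wallis.W (p - k)) ≤
      (2 / Real.pi) ^ 2 * (p * (p + 1) * (p + 2) / 6 + p * (p + 1) / 2 + p / 4) := by
    rw [← sum_half_mul_reflect, Finset.mul_sum]
    refine Finset.sum_le_sum fun k _ => ?_
    rw [pow_two, mul_mul_mul_comm]
    exact mul_le_mul (div_wallis_le _) (div_wallis_le _)
      (div_nonneg (by positivity) (Real.Wallis.W_pos _).le) (by positivity)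
  calc _ ≤ 64 / (3 * ((p + 1) * (p + 2))) * ((2 / Real.pi) ^ 2 *
          (p * (p + 1) * (p + 2) / 6 + p * (p + 1) / 2 + p / 4)) / ((p + 2 : ℕ) : ℝ) := by gcongr
    _ ≤ 64 / (3 * ((p + 1) * (p + 2))) * ((2 / Real.pi) ^ 2 *
          ((p + 1) * (p + 2) * (p + 5) / 6)) / ((p + 2 : ℕ) : ℝ) := by
        gcongr
        have : (0 : ℝ) ≤ p := by positivity
        nlinarith
    _ = _ := by
        push_cast
        field_simp
        ring

/-- The expected number of consecutive noncommuting pairs in a uniformly random reduced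
word for `w₀ ∈ S_n` is asymptotic to `(128/(9π²))·n`. -/
theorem expected_noncommuting_asymptotic :
    Filter.Tendsto (fun n : ℕ => expectedStat n noncommCount / (n : ℝ)) Filter.atTop
      (nhds (128 / (9 * Real.pi ^ 2))) := by
  rw [← Filter.tendsto_add_atTop_iff_nat 2]
  have hlim : ∀ c : ℝ, Filter.Tendsto (fun p : ℕ => c / ((p : ℝ) + 2)) Filter.atTop (nhds 0) := by
    intro c
    refine Filter.Tendsto.const_div_atTop ?_ c
    exact Filter.tendsto_atTop_add_const_right _ _ tendsto_natCast_atTop_atTop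
  have hlow := ((hlim 2).const_sub 1).const_mul (128 / (9 * Real.pi ^ 2))
  have hup := ((hlim 3).const_add 1).const_mul (128 / (9 * Real.pi ^ 2))
  rw [sub_zero, mul_one] at hlow
  rw [add_zero, mul_one] at hup
  refine tendsto_of_tendsto_of_tendsto_of_le_of_le' hlow hup ?_ ?_
  · filter_upwards [Filter.eventually_ge_atTop 1] with p hp
    exact le_expectedStat_noncommCount_div p hp
  · filter_upwards [Filter.eventually_ge_atTop 1] with p hp
    exact expectedStat_noncommCount_div_le p hp
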